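/- arXiv:1704.03898 — 2 statements merged into one kernel-verified Lean document; each statement's English description precedes it below -/
import Mathlib

section
/- (Sauer) Let H₃ be a universal triangle-free graph. (a) For every coloring of the edges of H₃ into finitely many colors, there is an induced subgraph H of H₃ isomorphic to H₃ whose edges take at most two colors. (b) There is a coloring of the edges of H₃ into two colors such that every induced subgraph of H₃ isomorphic to H₃ has edges of both colors. -/
/-- The Henson extension property (defining the universal triangle-free graph `H₃`): for all
disjoint finite sets `U, W` of vertices with `U` independent, there is a vertex (outside
`U ∪ W`) adjacent to every vertex of `U` and to no vertex of `W`. -/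
def HensonExtProp {V : Type} (H : SimpleGraph V) : Prop :=
  ∀ U W : Finset V, Disjoint U W → (∀ u ∈ U, ∀ u' ∈ U, ¬ H.Adj u u') →
    ∃ v : V, v ∉ U ∧ v ∉ W ∧ (∀ u ∈ U, H.Adj v u) ∧ (∀ w ∈ W, ¬ H.Adj v w)

namespace TriangleFreeRamsey

theorem exists_dense_color {α κ : Type*} [Preorder α] [Finite κ] (P : κ → α → Prop) (a : α)
    (h : ∀ b ≤ a, ∃ e, P e b) : ∃ b ≤ a, ∃ e, ∀ c ≤ b, ∃ d ≤ c, P e d := by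
  classical
  have := Fintype.ofFinite κ
  by_contra! hcon
  have key : ∀ s : Finset κ, ∃ b ≤ a, ∀ e ∈ s, ∀ d ≤ b, ¬ P e d := by
    intro s
    induction s using Finset.induction_on with
    | empty => exact ⟨a, le_rfl, by simp⟩
    | insert e s _ ih =>
      obtain ⟨b, hb, hs⟩ := ih
      obtain ⟨c, hc, hd⟩ := hcon b hb e
      refine ⟨c, hc.trans hb, fun e' he' => ?_⟩
      rcases Finset.mem_insert.1 he' with rfl | he'
      · exact hd
      · exact fun d hdc => hs e' he' d (hdc.trans hc)
  obtain ⟨b, hb, hs⟩ := key Finset.univ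
  obtain ⟨e, he⟩ := h b hb
  exact hs e (Finset.mem_univ e) b le_rfl he

theorem exists_eventually_of_finite {I κ : Type*} [Finite κ] (U : Ultrafilter I)
    {P : κ → I → Prop} (h : ∀ᶠ i in U, ∃ e, P e i) : ∃ e, ∀ᶠ i in U, P e i := by
  have h' : (⋃ e ∈ (Set.univ : Set κ), {i | P e i}) ∈ U := by
    filter_upwards [h] with i hi
    simpa using hi
  obtain ⟨e, -, he⟩ := (Ultrafilter.finite_biUnion_mem_iff Set.finite_univ).1 h'
  exact ⟨e, he⟩

/-- `y` lies outside `F` and its neighbours in `F` are exactly the members of `p`. -/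
def Realizes {V : Type*} (H : SimpleGraph V) (F p : Finset V) (y : V) : Prop :=
  y ∉ F ∧ ∀ u ∈ F, H.Adj y u ↔ u ∈ p

theorem Realizes.mono {V : Type*} {H : SimpleGraph V} {F p F' p' : Finset V} {y : V}
    (h : Realizes H F' p' y) (hF : F ⊆ F') (hp : ∀ u ∈ F, u ∈ p' ↔ u ∈ p) :
    Realizes H F p y :=
  ⟨fun hy => h.1 (hF hy), fun u hu => (h.2 u (hF hu)).trans (hp u hu)⟩

/-- A type over a finite vertex set `dom`, given by its independent set `nbrs` of neighbours,
together with a set of realizations that meets every extension of the type. -/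
structure Promise {V : Type*} (H : SimpleGraph V) where
  dom : Finset V
  nbrs : Finset V
  carrier : Set V
  nbrs_subset : nbrs ⊆ dom
  indep : ∀ u ∈ nbrs, ∀ u' ∈ nbrs, ¬ H.Adj u u'
  realizes : ∀ y ∈ carrier, Realizes H dom nbrs y
  dense : ∀ F p : Finset V, dom ⊆ F → p ⊆ F → (∀ u ∈ p, ∀ u' ∈ p, ¬ H.Adj u u') →
    (∀ u ∈ dom, u ∈ p ↔ u ∈ nbrs) → ∃ y ∈ carrier, Realizes H F p y

namespace Promise

variable {V κ : Type*} {H : SimpleGraph V}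

instance : Preorder (Promise H) where
  le a b := b.dom ⊆ a.dom ∧ (∀ u ∈ b.dom, u ∈ a.nbrs ↔ u ∈ b.nbrs) ∧ a.carrier ⊆ b.carrier
  le_refl a := ⟨subset_rfl, fun _ _ => Iff.rfl, subset_rfl⟩
  le_trans a b c hab hbc := ⟨hbc.1.trans hab.1,
    fun u hu => (hab.2.1 u (hbc.1 hu)).trans (hbc.2.1 u hu), hab.2.2.trans hbc.2.2⟩

/-- The realizations of an extension of the type underlying a promise. -/
def restrict (a : Promise H) (F p : Finset V) (hF : a.dom ⊆ F) (hp : p ⊆ F)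
    (hi : ∀ u ∈ p, ∀ u' ∈ p, ¬ H.Adj u u') (ha : ∀ u ∈ a.dom, u ∈ p ↔ u ∈ a.nbrs) :
    Promise H where
  dom := F
  nbrs := p
  carrier := {y ∈ a.carrier | Realizes H F p y}
  nbrs_subset := hp
  indep := hi
  realizes _ hy := hy.2
  dense F' p' hF' hp' hi' ha' := by
    obtain ⟨y, hy, hr⟩ := a.dense F' p' (hF.trans hF') hp' hi'
      fun u hu => (ha' u (hF hu)).trans (ha u hu)
    exact ⟨y, ⟨hy, hr.mono hF' ha'⟩, hr⟩

theorem restrict_le (a : Promise H) (F p : Finset V) (hF : a.dom ⊆ F) (hp : p ⊆ F)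
    (hi : ∀ u ∈ p, ∀ u' ∈ p, ¬ H.Adj u u') (ha : ∀ u ∈ a.dom, u ∈ p ↔ u ∈ a.nbrs) :
    a.restrict F p hF hp hi ha ≤ a :=
  ⟨hF, ha, fun _ hy => hy.1⟩

/-- Replace the set of realizations by a subset that is still dense. -/
def shrink (a : Promise H) (Y : Set V) (hY : ∀ b ≤ a, ∃ y ∈ b.carrier, y ∈ Y) :
    Promise H where
  dom := a.dom
  nbrs := a.nbrs
  carrier := a.carrier ∩ Y
  nbrs_subset := a.nbrs_subset
  indep := a.indep
  realizes y hy := a.realizes y hy.1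
  dense F p hF hp hi ha := by
    obtain ⟨y, hy, hyY⟩ := hY _ (a.restrict_le F p hF hp hi ha)
    exact ⟨y, ⟨hy.1, hyY⟩, hy.2⟩

theorem shrink_le (a : Promise H) (Y : Set V) (hY : ∀ b ≤ a, ∃ y ∈ b.carrier, y ∈ Y) :
    a.shrink Y hY ≤ a :=
  ⟨subset_rfl, fun _ _ => Iff.rfl, Set.inter_subset_left⟩

theorem carrier_nonempty (a : Promise H) : a.carrier.Nonempty := by
  obtain ⟨y, hy, -⟩ := a.dense a.dom a.nbrs subset_rfl a.nbrs_subset a.indep fun _ _ => Iff.rfl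
  exact ⟨y, hy⟩

theorem exists_le_monochromatic [Finite κ] (a : Promise H) (f : V → κ) :
    ∃ b ≤ a, ∃ e, ∀ y ∈ b.carrier, f y = e := by
  obtain ⟨b, hb, e, he⟩ := exists_dense_color (fun e (b : Promise H) => ∃ y ∈ b.carrier, f y = e) a
    fun b _ => by
      obtain ⟨y, hy⟩ := b.carrier_nonempty
      exact ⟨f y, y, hy, rfl⟩
  have hY : ∀ c ≤ b, ∃ y ∈ c.carrier, y ∈ f ⁻¹' {e} := fun c hc => by
    obtain ⟨d, hd, y, hy, hye⟩ := he c hc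
    exact ⟨y, hd.2.2 hy, hye⟩
  exact ⟨b.shrink _ hY, (b.shrink_le _ hY).trans hb, e, fun y hy => hy.2⟩

/-- Two promises over the same vertex set whose realizations may be adjacent. -/
def Apart (a b : Promise H) : Prop := a.dom = b.dom ∧ Disjoint a.nbrs b.nbrs

theorem Apart.symm {a b : Promise H} (h : a.Apart b) : b.Apart a := ⟨h.1.symm, h.2.symm⟩

/-- Some extension of the promise `b` makes all its realizations adjacent to `x` through edges
of color `e`. -/
def Good (c : Sym2 V → κ) (e : κ) (x : V) (b : Promise H) : Prop :=
  ∃ b' ≤ b, x ∈ b'.nbrs ∧ ∀ y ∈ b'.carrier, c s(x, y) = e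

theorem Good.mono {c : Sym2 V → κ} {e : κ} {x : V} {b b' : Promise H} (h : Good c e x b')
    (hb : b' ≤ b) : Good c e x b := by
  obtain ⟨d, hd, h⟩ := h
  exact ⟨d, hd.trans hb, h⟩

/-- Below `a` and `b`, there is always a realization `x` of the first promise such that the
second can be extended to one joined to `x` in color `e`. -/
def Arrow (c : Sym2 V → κ) (e : κ) (a b : Promise H) : Prop :=
  ∀ a' ≤ a, ∀ b' ≤ b, a'.Apart b' → ∃ x ∈ a'.carrier, Good c e x b'

theorem Arrow.mono {c : Sym2 V → κ} {e : κ} {a b a' b' : Promise H} (h : Arrow c e a b)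
    (ha : a' ≤ a) (hb : b' ≤ b) : Arrow c e a' b' :=
  fun _ ha' _ hb' => h _ (ha'.trans ha) _ (hb'.trans hb)

variable [DecidableEq V]

theorem Apart.exists_good [Finite κ] (c : Sym2 V → κ) {a b : Promise H} (h : a.Apart b) {x : V}
    (hx : x ∈ a.carrier) : ∃ e, Good c e x b := by
  have hr := a.realizes x hx
  have hxb : ∀ u ∈ b.nbrs, ¬ H.Adj x u := fun u hu hxu =>
    Finset.disjoint_left.1 h.2 ((hr.2 u (h.1 ▸ b.nbrs_subset hu)).1 hxu) hu
  have hxd : x ∉ b.dom := h.1 ▸ hr.1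
  have hle := b.restrict_le (insert x b.dom) (insert x b.nbrs) (Finset.subset_insert _ _)
    (Finset.insert_subset_insert _ b.nbrs_subset)
    (by
      intro u hu u' hu'
      rcases Finset.mem_insert.1 hu with rfl | hub <;>
        rcases Finset.mem_insert.1 hu' with rfl | hub'
      · exact H.irrefl
      · exact hxb u' hub'
      · exact fun h => hxb u hub h.symm
      · exact b.indep u hub u' hub')
    (by
      intro u hu
      have : u ≠ x := fun h => hxd (h ▸ hu)
      simp [this])
  obtain ⟨d, hd, e, he⟩ := (restrict _ _ _ _ _ _ _).exists_le_monochromatic fun y => c s(x, y)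
  exact ⟨e, d, hd.trans hle, (hd.2.1 x (Finset.mem_insert_self _ _)).2
    (Finset.mem_insert_self _ _), he⟩

/-- The extension of a promise by non-neighbours. -/
def lift (a : Promise H) (G : Finset V) : Promise H :=
  a.restrict (a.dom ∪ G) a.nbrs Finset.subset_union_left
    (a.nbrs_subset.trans Finset.subset_union_left) a.indep fun _ _ => Iff.rfl

@[simp] theorem lift_dom (a : Promise H) (G : Finset V) : (a.lift G).dom = a.dom ∪ G := rfl

@[simp] theorem lift_nbrs (a : Promise H) (G : Finset V) : (a.lift G).nbrs = a.nbrs := rfl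

theorem lift_le (a : Promise H) (G : Finset V) : a.lift G ≤ a := restrict_le ..

theorem le_lift {a b : Promise H} {G : Finset V} (h : b ≤ a) (hG : G ⊆ b.dom)
    (hn : ∀ u ∈ G, u ∈ b.nbrs → u ∈ a.nbrs) : b ≤ a.lift G := by
  have key : ∀ u ∈ a.dom ∪ G, u ∈ b.nbrs ↔ u ∈ a.nbrs := by
    intro u hu
    by_cases hua : u ∈ a.dom
    · exact h.2.1 u hua
    · have hG := (Finset.mem_union.1 hu).resolve_left hua
      exact ⟨hn u hG, fun h' => (hua (a.nbrs_subset h')).elim⟩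
  exact ⟨Finset.union_subset h.1 hG, key, fun y hy =>
    ⟨h.2.2 hy, (b.realizes y hy).mono (Finset.union_subset h.1 hG) key⟩⟩

theorem Apart.lift_right {a b a' : Promise H} (h : a.Apart b) (ha : a' ≤ a) :
    a'.Apart (b.lift a'.dom) := by
  refine ⟨(Finset.union_eq_right.2 (h.1 ▸ ha.1)).symm, Finset.disjoint_left.2 fun u hu hub => ?_⟩
  exact Finset.disjoint_left.1 h.2 ((ha.2.1 u (h.1 ▸ b.nbrs_subset hub)).1 hu) hub

theorem Apart.exists_arrow [Finite κ] (c : Sym2 V → κ) {a b : Promise H} (h : a.Apart b) :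
    ∃ a' ≤ a, ∃ b' ≤ b, a'.Apart b' ∧ ∃ e, Arrow c e a' b' := by
  obtain ⟨⟨⟨a', b'⟩, h'⟩, hle, e, he⟩ := exists_dense_color
    (fun e (z : {z : Promise H × Promise H // z.1.Apart z.2}) =>
      ∃ x ∈ z.1.1.carrier, Good c e x z.1.2) ⟨(a, b), h⟩ fun z _ => by
        obtain ⟨x, hx⟩ := z.1.1.carrier_nonempty
        obtain ⟨e, he⟩ := z.2.exists_good c hx
        exact ⟨e, x, hx, he⟩
  refine ⟨a', hle.1, b', hle.2, h', e, fun a₁ ha₁ b₁ hb₁ h₁ => ?_⟩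
  obtain ⟨z, hz, x, hx, hg⟩ := he ⟨(a₁, b₁), h₁⟩ ⟨ha₁, hb₁⟩
  exact ⟨x, hz.1.2.2 hx, hg.mono hz.2⟩

theorem Apart.exists_arrow_arrow [Finite κ] (c : Sym2 V → κ) {a b : Promise H}
    (h : a.Apart b) :
    ∃ a' ≤ a, ∃ b' ≤ b, a'.Apart b' ∧ ∃ e : κ × κ, Arrow c e.1 a' b' ∧ Arrow c e.2 b' a' := by
  obtain ⟨a₁, ha₁, b₁, hb₁, h₁, e₁, he₁⟩ := h.exists_arrow c
  obtain ⟨b₂, hb₂, a₂, ha₂, h₂, e₂, he₂⟩ := h₁.symm.exists_arrow c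
  exact ⟨a₂, ha₂.trans ha₁, b₂, hb₂.trans hb₁, h₂.symm, (e₁, e₂), he₁.mono ha₂ hb₂, he₂⟩

theorem exists_good_of_arrow {ι : Type*} (c : Sym2 V → κ) (s : Finset ι) (e : ι → κ)
    (a : Promise H) (b : ι → Promise H) (hab : ∀ i ∈ s, a.Apart (b i))
    (h : ∀ i ∈ s, Arrow c (e i) a (b i)) :
    ∃ x ∈ a.carrier, ∀ i ∈ s, Good c (e i) x (b i) := by
  classical
  suffices ∃ a' ≤ a, a'.dom = a.dom ∧ a'.nbrs = a.nbrs ∧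
      ∀ i ∈ s, ∀ x ∈ a'.carrier, Good c (e i) x (b i) by
    obtain ⟨a', ha', -, -, hg⟩ := this
    obtain ⟨x, hx⟩ := a'.carrier_nonempty
    exact ⟨x, ha'.2.2 hx, fun i hi => hg i hi x hx⟩
  induction s using Finset.induction_on with
  | empty => exact ⟨a, le_rfl, rfl, rfl, by simp⟩
  | insert i s _ ih =>
    obtain ⟨a', ha', hd, hn, hg⟩ := ih (fun j hj => hab j (Finset.mem_insert_of_mem hj))
      fun j hj => h j (Finset.mem_insert_of_mem hj)
    have hi := Finset.mem_insert_self i s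
    have hY : ∀ a'' ≤ a', ∃ x ∈ a''.carrier, x ∈ {x | Good c (e i) x (b i)} := fun a'' ha'' => by
      obtain ⟨x, hx, hgx⟩ := h i hi a'' (ha''.trans ha') _ (lift_le _ _)
        ((hab i hi).lift_right (ha''.trans ha'))
      exact ⟨x, hx, hgx.mono (lift_le _ _)⟩
    refine ⟨a'.shrink _ hY, (a'.shrink_le _ hY).trans ha', hd, hn, fun j hj x hx => ?_⟩
    rcases Finset.mem_insert.1 hj with rfl | hj
    · exact hx.2
    · exact hg j hj x hx.1

/-- The promise that only forbids neighbours in `F`. -/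
def free {V : Type} {H : SimpleGraph V} [DecidableEq V] (hH : HensonExtProp H) (F : Finset V) :
    Promise H where
  dom := F
  nbrs := ∅
  carrier := {y | Realizes H F ∅ y}
  nbrs_subset := by simp
  indep := by simp
  realizes _ hy := hy
  dense F' p hF _ hi ha := by
    obtain ⟨v, hvp, hvF, h1, h2⟩ := hH p (F' \ p) Finset.disjoint_sdiff hi
    have hv : Realizes H F' p v := ⟨fun hv => hvF (Finset.mem_sdiff.2 ⟨hv, hvp⟩), fun u hu =>
      ⟨fun h => by_contra fun hn => h2 u (Finset.mem_sdiff.2 ⟨hu, hn⟩) h, h1 u⟩⟩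
    exact ⟨v, hv.mono hF ha, hv⟩

/-- Some extensions of `a` and `q` have the arrows of colors `e.1` and `e.2` between them, where
the extension of `a` has no new neighbours in the domain of `q`. -/
def Settles (c : Sym2 V → κ) (e : κ × κ) (a q : Promise H) : Prop :=
  ∃ q' ≤ q, ∃ a' ≤ a, (∀ u ∈ q.dom, u ∈ a'.nbrs → u ∈ a.nbrs) ∧ a'.Apart q' ∧
    Arrow c e.1 a' q' ∧ Arrow c e.2 q' a'

theorem exists_settles [Finite κ] (c : Sym2 V → κ) {a q : Promise H} (hd : a.dom ⊆ q.dom)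
    (hn : Disjoint a.nbrs q.nbrs) : ∃ e, Settles c e a q := by
  have h : (a.lift q.dom).Apart q := ⟨Finset.union_eq_right.2 hd, hn⟩
  obtain ⟨a', ha', q', hq', h', e, he⟩ := h.exists_arrow_arrow c
  exact ⟨e, q', hq', a', ha'.trans (lift_le _ _),
    fun u hu => (ha'.2.1 u (Finset.mem_union_right _ hu)).1, h', he⟩

omit [DecidableEq V] in
theorem Settles.mono {c : Sym2 V → κ} {e : κ × κ} {a q q' : Promise H} (h : Settles c e a q')
    (hq : q' ≤ q) : Settles c e a q := by
  obtain ⟨q₁, hq₁, a₁, ha₁, hn, h⟩ := h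
  exact ⟨q₁, hq₁.trans hq, a₁, ha₁, fun u hu => hn u (hq.1 hu), h⟩

theorem Settles.lift {c : Sym2 V → κ} {e : κ × κ} {a q : Promise H} (h : Settles c e a q)
    {G : Finset V} (hG : G ⊆ q.dom) : Settles c e (a.lift G) q := by
  obtain ⟨q₁, hq₁, a₁, ha₁, hn, hap, h⟩ := h
  exact ⟨q₁, hq₁, a₁, le_lift ha₁ (hap.1 ▸ hG.trans hq₁.1) fun u hu => hn u (hG hu), hn, hap, h⟩

/-- `Settles` holds below `q`. -/
def Decides (c : Sym2 V → κ) (e : κ × κ) (a q : Promise H) : Prop :=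
  ∀ q' ≤ q, Settles c e a q'

omit [DecidableEq V] in
theorem Decides.mono {c : Sym2 V → κ} {e : κ × κ} {a q q' : Promise H} (h : Decides c e a q)
    (hq : q' ≤ q) : Decides c e a q' :=
  fun _ hq' => h _ (hq'.trans hq)

theorem Decides.lift {c : Sym2 V → κ} {e : κ × κ} {a q : Promise H} (h : Decides c e a q)
    {G : Finset V} (hG : G ⊆ q.dom) : Decides c e (a.lift G) q :=
  fun q' hq' => (h q' hq').lift (hG.trans hq'.1)

omit [DecidableEq V] in
theorem disjoint_nbrs_of_le {a q q' : Promise H} (hn : Disjoint a.nbrs q.nbrs)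
    (hd : a.dom ⊆ q.dom) (hq : q' ≤ q) : Disjoint a.nbrs q'.nbrs :=
  Finset.disjoint_left.2 fun u hu hu' => Finset.disjoint_left.1 hn hu
    ((hq.2.1 u (hd (a.nbrs_subset hu))).1 hu')

theorem exists_decides [Finite κ] (c : Sym2 V → κ) {a q : Promise H} (hd : a.dom ⊆ q.dom)
    (hn : Disjoint a.nbrs q.nbrs) : ∃ q' ≤ q, ∃ e, Decides c e a q' := by
  obtain ⟨q', hq', e, he⟩ := exists_dense_color (fun e (b : Promise H) => Settles c e a b) q
    fun (b : Promise H) (hb : b ≤ q) =>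
      exists_settles c (hd.trans hb.1) (disjoint_nbrs_of_le hn hd hb)
  refine ⟨q', hq', e, fun q₁ hq₁ => ?_⟩
  obtain ⟨d, hd, h⟩ := he q₁ hq₁
  exact h.mono hd

theorem exists_generic {V : Type} {H : SimpleGraph V} [DecidableEq V] [Finite κ]
    (hH : HensonExtProp H) (c : Sym2 V → κ) :
    ∃ U : Ultrafilter (Promise H), (∀ F, ∀ᶠ q : Promise H in U, q ≤ free hH F) ∧
      ∀ a, ∀ᶠ q : Promise H in U, ∃ e, Decides c e a q := by
  classical
  have key : ∀ z : Finset V × Finset (Promise H), ∃ q ≤ free hH z.1,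
      ∀ a ∈ z.2, a.dom ⊆ z.1 → ∃ e, Decides c e a q := by
    rintro ⟨F, T⟩
    induction T using Finset.induction_on with
    | empty => exact ⟨_, le_rfl, by simp⟩
    | insert a T _ ih =>
      obtain ⟨q, hq, hT⟩ := ih
      by_cases hF : a.dom ⊆ F
      · obtain ⟨q', hq', he⟩ := exists_decides c (a := a) (hF.trans hq.1)
          (disjoint_nbrs_of_le (q := free hH F) (Finset.disjoint_empty_right _) hF hq)
        refine ⟨q', hq'.trans hq, fun b hb hbF => ?_⟩
        rcases Finset.mem_insert.1 hb with rfl | hb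
        · exact he
        · obtain ⟨e, he⟩ := hT b hb hbF
          exact ⟨e, he.mono hq'⟩
      · refine ⟨q, hq, fun b hb hbF => ?_⟩
        rcases Finset.mem_insert.1 hb with rfl | hb
        · exact absurd hbF hF
        · exact hT b hb hbF
  choose g hg hgd using key
  have hU : ∀ z : Finset V × Finset (Promise H),
      ∀ᶠ z' in (Ultrafilter.of Filter.atTop : Ultrafilter (Finset V × Finset (Promise H))),
        z ≤ z' :=
    fun z => Ultrafilter.of_le _ (Filter.eventually_ge_atTop z)
  refine ⟨(Ultrafilter.of Filter.atTop).map g, fun F => ?_, fun a => ?_⟩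
  · rw [Ultrafilter.coe_map, Filter.eventually_map]
    filter_upwards [hU (F, ∅)] with z hz
    refine (hg z).trans ⟨hz.1, fun _ _ => Iff.rfl, fun y hy => hy.mono hz.1 fun _ _ => Iff.rfl⟩
  · rw [Ultrafilter.coe_map, Filter.eventually_map]
    filter_upwards [hU (a.dom, {a})] with z hz
    exact hgd z a (hz.2 (Finset.mem_singleton_self a)) hz.1

/-- The color pair `e` remains available below `a` for generic promises. -/
def Stable (U : Ultrafilter (Promise H)) (c : Sym2 V → κ) (e : κ × κ) (a : Promise H) : Prop :=
  ∀ b ≤ a, ∃ d ≤ b, ∀ᶠ q : Promise H in U, Decides c e d q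

omit [DecidableEq V] in
theorem Stable.mono {U : Ultrafilter (Promise H)} {c : Sym2 V → κ} {e : κ × κ} {a b : Promise H}
    (h : Stable U c e a) (hb : b ≤ a) : Stable U c e b :=
  fun _ hd => h _ (hd.trans hb)

omit [DecidableEq V] in
theorem exists_stable [Finite κ] {U : Ultrafilter (Promise H)} {c : Sym2 V → κ}
    (hU : ∀ a, ∀ᶠ q : Promise H in U, ∃ e, Decides c e a q) :
    ∃ e, ∀ᶠ q : Promise H in U, ∃ q' ≤ q, Stable U c e q' := by
  refine exists_eventually_of_finite U (Filter.Eventually.of_forall fun a => ?_)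
  obtain ⟨b, hb, e, he⟩ := exists_dense_color
    (fun e (b : Promise H) => ∀ᶠ q : Promise H in U, Decides c e b q) a
    fun b _ => exists_eventually_of_finite U (hU b)
  exact ⟨e, b, hb, he⟩

/-- Finitely many promises can be extended one after the other, together with `q`, without
giving them new common neighbours. -/
theorem exists_extension_family {ι : Type*} (s : Finset ι) (Φ : ι → Promise H → Promise H → Prop)
    (hΦ : ∀ i a q q', Φ i a q → q' ≤ q → Φ i (a.lift q'.dom) q')
    (t : ι → Promise H) (q : Promise H) (hd : ∀ i, (t i).dom ⊆ q.dom)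
    (hn : ∀ i, Disjoint (t i).nbrs q.nbrs)
    (hstep : ∀ i ∈ s, ∀ q₁ ≤ q, ∃ q₂ ≤ q₁, ∃ a ≤ t i,
      (∀ u ∈ q₁.dom, u ∈ a.nbrs → u ∈ (t i).nbrs) ∧ a.Apart q₂ ∧ Φ i a q₂) :
    ∃ t' : ι → Promise H, ∃ q' ≤ q, (∀ i, t' i ≤ t i) ∧ (∀ i, (t' i).Apart q') ∧
      (∀ i ∈ s, Φ i (t' i) q') ∧
      ∀ i j, i ≠ j → Disjoint (t i).nbrs (t j).nbrs → Disjoint (t' i).nbrs (t' j).nbrs := by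
  classical
  suffices ∃ t' : ι → Promise H, ∃ q' ≤ q, (∀ i, t' i ≤ t i) ∧ (∀ i, (t' i).Apart q') ∧
      (∀ i ∈ s, Φ i (t' i) q') ∧ (∀ i ∉ s, (t' i).nbrs = (t i).nbrs) ∧
      ∀ i j, i ≠ j → Disjoint (t i).nbrs (t j).nbrs → Disjoint (t' i).nbrs (t' j).nbrs by
    obtain ⟨t', q', h1, h2, h3, h4, -, h5⟩ := this
    exact ⟨t', q', h1, h2, h3, h4, h5⟩
  induction s using Finset.induction_on with
  | empty =>
    exact ⟨fun i => (t i).lift q.dom, q, le_rfl, fun i => lift_le _ _,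
      fun i => ⟨Finset.union_eq_right.2 (hd i), hn i⟩, by simp, fun _ _ => rfl, fun _ _ _ h => h⟩
  | insert i s his ih =>
    obtain ⟨t', q', hq', hle, hap, hs, hns, hdisj⟩ :=
      ih fun j hj => hstep j (Finset.mem_insert_of_mem hj)
    obtain ⟨q₂, hq₂, a, ha, hau, haq, hΦa⟩ := hstep i (Finset.mem_insert_self i s) q' hq'
    have hai : ∀ j, j ≠ i → Disjoint (t i).nbrs (t j).nbrs → Disjoint a.nbrs (t' j).nbrs := by
      intro j hj hij
      refine Finset.disjoint_left.2 fun u hu huj => ?_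
      have hui := hau u ((hap j).1 ▸ (t' j).nbrs_subset huj) hu
      exact Finset.disjoint_left.1 (hdisj i j hj.symm hij) (hns i his ▸ hui) huj
    refine ⟨Function.update (fun j => (t' j).lift q₂.dom) i a, q₂, hq₂.trans hq',
      fun j => ?_, fun j => ?_, fun j hj => ?_, fun j hj => ?_, fun j k hjk h => ?_⟩
    · rcases eq_or_ne j i with rfl | hj
      · simpa using ha
      · simpa [hj] using (lift_le _ _).trans (hle j)
    · rcases eq_or_ne j i with rfl | hj
      · simpa using haq
      · rw [Function.update_of_ne hj]
        exact ((hap j).symm.lift_right hq₂).symm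
    · rcases eq_or_ne j i with rfl | hji
      · simpa using hΦa
      · rw [Function.update_of_ne hji]
        exact hΦ j _ _ _ (hs j ((Finset.mem_insert.1 hj).resolve_left hji)) hq₂
    · rw [Finset.mem_insert, not_or] at hj
      rw [Function.update_of_ne hj.1]
      exact hns j hj.2
    · rcases eq_or_ne j i with rfl | hj
      · simpa [hjk.symm] using hai k hjk.symm h
      · rcases eq_or_ne k i with rfl | hk
        · simpa [hj] using (hai j hj h.symm).symm
        · simpa [hj, hk] using hdisj j k hjk h

/-- A finite family of stable promises can be extended so that a new stable promise becomes
available, with arrows of the two stable colors. -/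
theorem exists_new_promise {V : Type} {H : SimpleGraph V} [DecidableEq V]
    {hH : HensonExtProp H} {c : Sym2 V → κ} {e : κ × κ} {U : Ultrafilter (Promise H)}
    (hfree : ∀ F, ∀ᶠ q : Promise H in U, q ≤ free hH F)
    (hU : ∀ᶠ q : Promise H in U, ∃ q' ≤ q, Stable U c e q')
    {ι : Type*} (s : Finset ι) (t : ι → Promise H) (F : Finset V) (hF : ∀ i, (t i).dom = F)
    (hs : ∀ i ∈ s, Stable U c e (t i)) :
    ∃ t' : ι → Promise H, ∃ q ≤ free hH F, Stable U c e q ∧ (∀ i, t' i ≤ t i) ∧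
      (∀ i, (t' i).Apart q) ∧ (∀ i ∈ s, Arrow c e.1 (t' i) q ∧ Arrow c e.2 q (t' i)) ∧
      ∀ i j, i ≠ j → Disjoint (t i).nbrs (t j).nbrs → Disjoint (t' i).nbrs (t' j).nbrs := by
  obtain ⟨t₁, q₁, hq₁, hle₁, hap₁, hs₁, hdisj₁⟩ := exists_extension_family s
    (fun _ a _ => ∀ᶠ q : Promise H in U, Decides c e a q)
    (fun _ a _ q' h _ => by
      filter_upwards [h, hfree q'.dom] with r hr hrq
      exact hr.lift hrq.1)
    t (free hH F) (fun i => (hF i).subset) (fun i => Finset.disjoint_empty_right _)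
    (by
      intro i hi q hq
      have hqi : Disjoint (t i).nbrs q.nbrs :=
        disjoint_nbrs_of_le (q := free hH F) (Finset.disjoint_empty_right _) (hF i).subset hq
      have hap : ((t i).lift q.dom).Apart q :=
        ⟨Finset.union_eq_right.2 ((hF i).subset.trans hq.1), hqi⟩
      obtain ⟨a, ha, hd⟩ := hs i hi _ (lift_le (t i) q.dom)
      exact ⟨q.lift a.dom, lift_le _ _, a, ha.trans (lift_le _ _),
        fun u hu => (ha.2.1 u (Finset.mem_union_right _ hu)).1, hap.lift_right ha, hd⟩)
  have hall : ∀ᶠ q : Promise H in U, ∀ i ∈ s, Decides c e (t₁ i) q :=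
    (Filter.eventually_all_finset s).2 hs₁
  obtain ⟨q₂, hdec, hfr, q₃, hq₃, hst⟩ := (hall.and ((hfree q₁.dom).and hU)).exists
  have hq₃' := hq₃.trans hfr
  obtain ⟨t', q, hq, hle, hap, hs', hdisj⟩ := exists_extension_family s
    (fun _ a q => Arrow c e.1 a q ∧ Arrow c e.2 q a)
    (fun _ a q q' h hq => ⟨h.1.mono (lift_le _ _) hq, h.2.mono hq (lift_le _ _)⟩)
    t₁ q₃ (fun i => (hap₁ i).1 ▸ hq₃'.1)
    (fun i => disjoint_nbrs_of_le (q := free hH q₁.dom) (Finset.disjoint_empty_right _)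
      (hap₁ i).1.subset hq₃')
    (fun i hi q hq => by
      obtain ⟨q', hq', a, ha, hau, hap, har⟩ := hdec i hi q (hq.trans hq₃)
      exact ⟨q', hq', a, ha, hau, hap, har⟩)
  have hF₁ : free hH q₁.dom ≤ free hH F :=
    ⟨hq₁.1, fun _ _ => Iff.rfl, fun y hy => hy.mono hq₁.1 fun _ _ => Iff.rfl⟩
  exact ⟨t', q, (hq.trans hq₃').trans hF₁, hst.mono hq, fun i => (hle i).trans (hle₁ i), hap, hs',
    fun i j hij h => hdisj i j hij (hdisj₁ i j hij h)⟩

/-- A family of promises over `F`, indexed by the sets of tokens below `n`, such that promises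
of disjoint sets of tokens have arrows of the colors `e` between them. -/
structure Coherent (U : Ultrafilter (Promise H)) (c : Sym2 V → κ) (e : κ × κ) (n : ℕ)
    (F : Finset V) (t : Finset ℕ → Promise H) : Prop where
  dom_eq : ∀ S, (t S).dom = F
  stable : ∀ S ⊆ Finset.range n, S.Nonempty → Stable U c e (t S)
  disjoint : ∀ S ⊆ Finset.range n, S.Nonempty → ∀ T ⊆ Finset.range n, T.Nonempty →
    Disjoint S T → Disjoint (t S).nbrs (t T).nbrs
  arrow : ∀ S ⊆ Finset.range n, S.Nonempty → ∀ T ⊆ Finset.range n, T.Nonempty →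
    Disjoint S T → Arrow c e.1 (t S) (t T) ∨ Arrow c e.2 (t S) (t T)

/-- The vertex `x` is a neighbour in the promise of a set `T` of tokens only if `m ∈ T`, and it
is one, through edges of the colors `e`, if moreover `T` is disjoint from `R`. -/
structure Linked (c : Sym2 V → κ) (e : κ × κ) (n : ℕ) (F : Finset V)
    (t : Finset ℕ → Promise H) (x : V) (m : ℕ) (R : Finset ℕ) : Prop where
  mem : x ∈ F
  notMem_nbrs : ∀ T ⊆ Finset.range n, T.Nonempty → m ∉ T → x ∉ (t T).nbrs
  mem_nbrs : ∀ T ⊆ Finset.range n, T.Nonempty → m ∈ T → Disjoint T R → x ∈ (t T).nbrs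
  color : ∀ T ⊆ Finset.range n, T.Nonempty → m ∈ T → Disjoint T R →
    ∀ y ∈ (t T).carrier, c s(x, y) = e.1 ∨ c s(x, y) = e.2

omit [DecidableEq V] in
theorem Linked.mono {c : Sym2 V → κ} {e : κ × κ} {n : ℕ} {F F' : Finset V}
    {t t' : Finset ℕ → Promise H} {x : V} {m : ℕ} {R : Finset ℕ} (h : Linked c e n F t x m R)
    (ht : ∀ S, (t S).dom = F) (hF : F ⊆ F') (hle : ∀ S, t' S ≤ t S) :
    Linked c e n F' t' x m R where
  mem := hF h.mem
  notMem_nbrs T hT hne hm hx :=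
    h.notMem_nbrs T hT hne hm (((hle T).2.1 x ((ht T).symm ▸ h.mem)).1 hx)
  mem_nbrs T hT hne hm hR :=
    ((hle T).2.1 x ((ht T).symm ▸ h.mem)).2 (h.mem_nbrs T hT hne hm hR)
  color T hT hne hm hR y hy := h.color T hT hne hm hR y ((hle T).2.2 hy)

theorem Coherent.exists_succ {V : Type} {H : SimpleGraph V} [DecidableEq V]
    {hH : HensonExtProp H} {c : Sym2 V → κ} {e : κ × κ} {U : Ultrafilter (Promise H)}
    (hfree : ∀ F, ∀ᶠ q : Promise H in U, q ≤ free hH F)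
    (hU : ∀ᶠ q : Promise H in U, ∃ q' ≤ q, Stable U c e q') {n : ℕ} {F : Finset V}
    {t : Finset ℕ → Promise H} (h : Coherent U c e n F t) :
    ∃ F' t', Coherent U c e (n + 1) F' t' ∧
      ∀ x m R, m < n → Linked c e n F t x m R → Linked c e (n + 1) F' t' x m R := by
  obtain ⟨t₁, q, hq, hqs, hle, hap, harr, hdisj⟩ := exists_new_promise hfree hU
    ((Finset.range n).powerset.erase ∅) t F h.dom_eq fun S hS => by
      rw [Finset.mem_erase, Finset.mem_powerset, ← Finset.nonempty_iff_ne_empty] at hS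
      exact h.stable S hS.2 hS.1
  have hmem : ∀ S ⊆ Finset.range n, S.Nonempty → S ∈ (Finset.range n).powerset.erase ∅ :=
    fun S hS hne => Finset.mem_erase.2 ⟨hne.ne_empty, Finset.mem_powerset.2 hS⟩
  have hcase : ∀ S ⊆ Finset.range (n + 1), S.Nonempty →
      S = {n} ∨ S ≠ {n} ∧ S.erase n ⊆ Finset.range n ∧ (S.erase n).Nonempty := by
    intro S hS hne
    by_cases hSn : S = {n}
    · exact Or.inl hSn
    · refine Or.inr ⟨hSn, fun k hk => ?_, ?_⟩
      · have h1 := Finset.mem_range.1 (hS (Finset.mem_of_mem_erase hk))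
        have h2 := Finset.ne_of_mem_erase hk
        exact Finset.mem_range.2 (by omega)
      · rw [Finset.nonempty_iff_ne_empty, Ne, Finset.erase_eq_empty_iff]
        exact not_or.2 ⟨hne.ne_empty, hSn⟩
  have hdS : ∀ S T : Finset ℕ, Disjoint S T → Disjoint (S.erase n) (T.erase n) := fun S T hST =>
    hST.mono (Finset.erase_subset _ _) (Finset.erase_subset _ _)
  have hne : ∀ S T : Finset ℕ, S.Nonempty → Disjoint S T → S ≠ T := by
    rintro S T hS hST rfl
    exact hS.ne_empty (disjoint_self.1 hST)
  refine ⟨q.dom, fun S => if S = {n} then q else t₁ (S.erase n), ⟨fun S => ?_,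
    fun S hS hSn => ?_, fun S hS hSn T hT hTn hST => ?_, fun S hS hSn T hT hTn hST => ?_⟩,
    fun x m R hm hx => ?_⟩
  · split_ifs
    exacts [rfl, (hap _).1]
  · rcases hcase S hS hSn with rfl | ⟨h1, h2, h3⟩
    · simpa using hqs
    · simpa [h1] using (h.stable _ h2 h3).mono (hle _)
  · rcases hcase S hS hSn with rfl | ⟨h1, h2, h3⟩
    · have hT' : T ≠ {n} := (hne _ _ hSn hST).symm
      simpa [hT'] using (hap (T.erase n)).2.symm
    · rcases hcase T hT hTn with rfl | ⟨h1', h2', h3'⟩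
      · simpa [h1] using (hap (S.erase n)).2
      · simpa [h1, h1'] using hdisj _ _ (hne _ _ h3 (hdS _ _ hST))
          (h.disjoint _ h2 h3 _ h2' h3' (hdS _ _ hST))
  · rcases hcase S hS hSn with rfl | ⟨h1, h2, h3⟩
    · rcases hcase T hT hTn with rfl | ⟨h1', h2', h3'⟩
      · exact absurd rfl (hne _ _ hSn hST)
      · simpa [h1'] using Or.inr (harr _ (hmem _ h2' h3')).2
    · rcases hcase T hT hTn with rfl | ⟨h1', h2', h3'⟩
      · simpa [h1] using Or.inl (harr _ (hmem _ h2 h3)).1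
      · simpa [h1, h1'] using (h.arrow _ h2 h3 _ h2' h3' (hdS _ _ hST)).imp
          (fun h => h.mono (hle _) (hle _)) fun h => h.mono (hle _) (hle _)
  · have hx₁ := hx.mono h.dom_eq hq.1 hle
    have hxq : x ∉ q.nbrs := fun hxq => by simpa [free] using (hq.2.1 x hx.mem).1 hxq
    refine ⟨hx₁.mem, fun T hT hTn hmT => ?_, fun T hT hTn hmT hTR => ?_,
      fun T hT hTn hmT hTR => ?_⟩
    · rcases hcase T hT hTn with rfl | ⟨h1, h2, h3⟩
      · simpa using hxq
      · simpa [h1] using hx₁.notMem_nbrs _ h2 h3 fun hm' => hmT (Finset.mem_of_mem_erase hm')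
    · rcases hcase T hT hTn with rfl | ⟨h1, h2, h3⟩
      · exact absurd (Finset.mem_singleton.1 hmT) hm.ne
      · simpa [h1] using hx₁.mem_nbrs _ h2 h3 (Finset.mem_erase.2 ⟨hm.ne, hmT⟩)
          (hTR.mono_left (Finset.erase_subset _ _))
    · rcases hcase T hT hTn with rfl | ⟨h1, h2, h3⟩
      · exact absurd (Finset.mem_singleton.1 hmT) hm.ne
      · simpa [h1] using hx₁.color _ h2 h3 (Finset.mem_erase.2 ⟨hm.ne, hmT⟩)
          (hTR.mono_left (Finset.erase_subset _ _))

theorem Coherent.exists_vertex {c : Sym2 V → κ} {e : κ × κ} {U : Ultrafilter (Promise H)}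
    {n : ℕ} {F : Finset V} {t : Finset ℕ → Promise H} (h : Coherent U c e n F t) {m : ℕ}
    {R : Finset ℕ} (hR : R ⊆ Finset.range n) (hRn : R.Nonempty) :
    ∃ x ∈ (t R).carrier, ∃ F' t', Coherent U c e n F' t' ∧ Linked c e n F' t' x m R ∧
      F ⊆ F' ∧ ∀ S, t' S ≤ t S := by
  classical
  set s : Finset (Finset ℕ) := {T ∈ (Finset.range n).powerset | T.Nonempty ∧ Disjoint R T} with hs
  have hms : ∀ T, T ∈ s ↔ T ⊆ Finset.range n ∧ T.Nonempty ∧ Disjoint R T := by simp [hs]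
  have hcol : ∀ T, ∃ ε, (ε = e.1 ∨ ε = e.2) ∧ (T ∈ s → Arrow c ε (t R) (t T)) := by
    intro T
    by_cases hT : T ∈ s
    · obtain ⟨h1, h2, h3⟩ := (hms T).1 hT
      rcases h.arrow R hR hRn T h1 h2 h3 with ha | ha
      exacts [⟨_, Or.inl rfl, fun _ => ha⟩, ⟨_, Or.inr rfl, fun _ => ha⟩]
    · exact ⟨_, Or.inl rfl, fun hT' => absurd hT' hT⟩
  choose ε hε hεa using hcol
  obtain ⟨x, hx, hg⟩ := exists_good_of_arrow c s ε (t R) t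
    (fun T hT => ⟨(h.dom_eq R).trans (h.dom_eq T).symm, by
      obtain ⟨h1, h2, h3⟩ := (hms T).1 hT
      exact h.disjoint R hR hRn T h1 h2 h3⟩) hεa
  have hxF : x ∉ F := h.dom_eq R ▸ ((t R).realizes x hx).1
  have key : ∀ T, ∃ b ≤ t T, (m ∉ T → b = t T) ∧ (T ∈ s → m ∈ T →
      x ∈ b.nbrs ∧ ∀ y ∈ b.carrier, c s(x, y) = ε T) := by
    intro T
    by_cases hT : T ∈ s ∧ m ∈ T
    · obtain ⟨b, hb, hxb, hbc⟩ := hg T hT.1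
      exact ⟨b, hb, fun hm' => absurd hT.2 hm', fun _ _ => ⟨hxb, hbc⟩⟩
    · exact ⟨t T, le_rfl, fun _ => rfl, fun h1 h2 => absurd ⟨h1, h2⟩ hT⟩
  choose b hb hbm hbs using key
  have hbd : ∀ S T, Disjoint (t S).nbrs (t T).nbrs → Disjoint (t S).nbrs (b T).nbrs :=
    fun S T hST => disjoint_nbrs_of_le hST ((h.dom_eq S).trans (h.dom_eq T).symm).subset (hb T)
  set G : Finset V := insert x (F ∪ (Finset.range n).powerset.biUnion fun T => (b T).dom) with hG
  have hxG : x ∈ G := Finset.mem_insert_self _ _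
  have hFG : F ⊆ G := Finset.subset_union_left.trans (Finset.subset_insert _ _)
  have hbG : ∀ T ⊆ Finset.range n, (b T).dom ⊆ G := fun T hT u hu =>
    Finset.mem_insert_of_mem (Finset.mem_union_right _
      (Finset.mem_biUnion.2 ⟨T, Finset.mem_powerset.2 hT, hu⟩))
  have hle : ∀ S, (if S ⊆ Finset.range n then b S else t S).lift G ≤ t S := fun S => by
    refine (lift_le _ _).trans ?_
    split_ifs
    exacts [hb S, le_rfl]
  refine ⟨x, hx, G, fun S => (if S ⊆ Finset.range n then b S else t S).lift G,
    ⟨fun S => ?_, fun S hS hSn => (h.stable S hS hSn).mono (hle S),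
      fun S hS hSn T hT hTn hST => ?_, fun S hS hSn T hT hTn hST => ?_⟩,
    ⟨hxG, fun T hT hTn hmT => ?_, fun T hT hTn hmT hTR => ?_, fun T hT hTn hmT hTR y hy => ?_⟩,
    hFG, hle⟩
  · rw [lift_dom, Finset.union_eq_right]
    split_ifs with hS
    exacts [hbG S hS, (h.dom_eq S).subset.trans hFG]
  · have hd := h.disjoint S hS hSn T hT hTn hST
    simp only [lift_nbrs, if_pos hS, if_pos hT]
    by_cases hmS : m ∈ S
    · rw [hbm T (Finset.disjoint_left.1 hST hmS)]
      exact (hbd T S hd.symm).symm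
    · rw [hbm S hmS]
      exact hbd S T hd
  · exact (h.arrow S hS hSn T hT hTn hST).imp (fun ha => ha.mono (hle S) (hle T))
      fun ha => ha.mono (hle S) (hle T)
  · simp only [lift_nbrs, if_pos hT]
    rw [hbm T hmT]
    exact fun hxT => hxF (h.dom_eq T ▸ (t T).nbrs_subset hxT)
  · simp only [lift_nbrs, if_pos hT]
    exact (hbs T ((hms T).2 ⟨hT, hTn, hTR.symm⟩) hmT).1
  · simp only [if_pos hT] at hy
    have := (hbs T ((hms T).2 ⟨hT, hTn, hTR.symm⟩) hmT).2 y ((lift_le _ _).2.2 hy)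
    rw [this]
    exact hε T

theorem Coherent.exists_step {V : Type} {H : SimpleGraph V} [DecidableEq V]
    {hH : HensonExtProp H} {c : Sym2 V → κ} {e : κ × κ} {U : Ultrafilter (Promise H)}
    (hfree : ∀ F, ∀ᶠ q : Promise H in U, q ≤ free hH F)
    (hU : ∀ᶠ q : Promise H in U, ∃ q' ≤ q, Stable U c e q') {n : ℕ} {F : Finset V}
    {t : Finset ℕ → Promise H} (h : Coherent U c e n F t) {R : Finset ℕ}
    (hR : R ⊆ Finset.range (n + 1)) (hRn : R.Nonempty) :
    ∃ x F' t', Coherent U c e (n + 2) F' t' ∧ Linked c e (n + 2) F' t' x (n + 1) R ∧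
      ∀ y m R', m < n → Linked c e n F t y m R' →
        Linked c e (n + 2) F' t' y m R' ∧ y ≠ x ∧ (m ∉ R → ¬ H.Adj x y) ∧
        (m ∈ R → Disjoint R R' → H.Adj x y ∧ (c s(y, x) = e.1 ∨ c s(y, x) = e.2)) := by
  obtain ⟨F₁, t₁, h₁, hl₁⟩ := h.exists_succ hfree hU
  obtain ⟨F₂, t₂, h₂, hl₂⟩ := h₁.exists_succ hfree hU
  have hR₂ : R ⊆ Finset.range (n + 1 + 1) := hR.trans (Finset.range_subset_range.2 (by omega))
  obtain ⟨x, hx, F₃, t₃, h₃, hl₃, hF, hle⟩ := h₂.exists_vertex (m := n + 1) hR₂ hRn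
  refine ⟨x, F₃, t₃, h₃, hl₃, fun y m R' hm hy => ?_⟩
  have hy₂ := hl₂ y m R' (by omega) (hl₁ y m R' hm hy)
  have hr := (t₂ R).realizes x hx
  rw [h₂.dom_eq] at hr
  refine ⟨hy₂.mono h₂.dom_eq hF hle, fun hyx => hr.1 (hyx ▸ hy₂.mem),
    fun hmR hxy => hy₂.notMem_nbrs R hR₂ hRn hmR ((hr.2 y hy₂.mem).1 hxy), fun hmR hRR =>
    ⟨(hr.2 y hy₂.mem).2 (hy₂.mem_nbrs R hR₂ hRn hmR hRR), hy₂.color R hR₂ hRn hmR hRR x hx⟩⟩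

theorem exists_embedding {V : Type} [Finite κ] {H : SimpleGraph V} (hH : HensonExtProp H)
    (c : Sym2 V → κ) (G : SimpleGraph ℕ) (hG : G.CliqueFree 3) :
    ∃ (e : κ × κ) (w : G ↪g H), ∀ i j, G.Adj i j →
      c s(w i, w j) = e.1 ∨ c s(w i, w j) = e.2 := by
  classical
  obtain ⟨U, hfree, hdec⟩ := exists_generic hH c
  obtain ⟨e, hU⟩ := exists_stable hdec
  let R : ℕ → Finset ℕ := fun i =>
    insert (2 * i) (((Finset.range i).filter fun j => G.Adj j i).image fun j => 2 * j + 1)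
  have hRsub : ∀ i, R i ⊆ Finset.range (2 * i + 1) := by
    intro i k hk
    simp only [R, Finset.mem_insert, Finset.mem_image, Finset.mem_filter, Finset.mem_range] at hk ⊢
    rcases hk with rfl | ⟨j, ⟨hj, -⟩, rfl⟩ <;> omega
  have hmemR : ∀ i j, i < j → (2 * i + 1 ∈ R j ↔ G.Adj i j) := by
    intro i j hij
    simp only [R, Finset.mem_insert, Finset.mem_image, Finset.mem_filter, Finset.mem_range]
    constructor
    · rintro (h | ⟨k, ⟨-, hk⟩, hki⟩)
      · omega
      · obtain rfl : k = i := by omega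
        exact hk
    · exact fun h => Or.inr ⟨i, ⟨hij, h⟩, rfl⟩
  have hdisR : ∀ i j, i < j → G.Adj i j → Disjoint (R j) (R i) := by
    intro i j hij hadj
    refine Finset.disjoint_left.2 fun k hkj hki => ?_
    simp only [R, Finset.mem_insert, Finset.mem_image, Finset.mem_filter, Finset.mem_range]
      at hkj hki
    rcases hkj with rfl | ⟨a, ⟨ha, haj⟩, rfl⟩
    · rcases hki with hki | ⟨b, ⟨hb, -⟩, hki⟩ <;> omega
    · rcases hki with hki | ⟨b, ⟨hb, hbi⟩, hki⟩
      · omega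
      · obtain rfl : b = a := by omega
        exact hG {b, i, j} (SimpleGraph.is3Clique_triple_iff.2 ⟨hbi, haj, hadj⟩)
  have hstep : ∀ i, ∀ z : {z : Finset V × (Finset ℕ → Promise H) //
      Coherent U c e (2 * i) z.1 z.2}, _ := fun i z =>
    z.2.exists_step hfree hU (hRsub i) (Finset.insert_nonempty _ _)
  choose x F' t' hcoh hlink hpres using hstep
  let st : ∀ i, {z : Finset V × (Finset ℕ → Promise H) // Coherent U c e (2 * i) z.1 z.2} :=
    fun i => Nat.rec ⟨(∅, fun _ => free hH ∅), by
      constructor <;> simp [free, Finset.not_nonempty_empty]⟩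
      (fun i z => ⟨(F' i z, t' i z), hcoh i z⟩) i
  have hl : ∀ i j, i + 1 ≤ j →
      Linked c e (2 * j) (st j).1.1 (st j).1.2 (x i (st i)) (2 * i + 1) (R i) := by
    intro i j hij
    induction j, hij using Nat.le_induction with
    | base => exact hlink i (st i)
    | succ j hij ih => exact (hpres j (st j) _ _ _ (by omega) ih).1
  have hp := fun i j (hij : i < j) => (hpres j (st j) _ _ _ (by omega) (hl i j hij)).2
  have hadj : ∀ i j, i < j → (H.Adj (x i (st i)) (x j (st j)) ↔ G.Adj i j) := by
    intro i j hij
    obtain ⟨-, h1, h2⟩ := hp i j hij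
    rw [hmemR i j hij] at h1 h2
    exact ⟨fun h => by_contra fun hn => h1 hn h.symm,
      fun h => (h2 h (hdisR i j hij h)).1.symm⟩
  refine ⟨e, ⟨⟨fun i => x i (st i), fun i j hij => ?_⟩, fun {i j} => ?_⟩, fun i j hij => ?_⟩
  · rcases lt_trichotomy i j with h | h | h
    exacts [absurd hij (hp i j h).1, h, absurd hij.symm (hp j i h).1]
  · rcases lt_trichotomy i j with h | rfl | h
    · exact hadj i j h
    · simp
    · exact (H.adj_comm _ _).trans ((hadj j i h).trans (G.adj_comm _ _))
  · rcases lt_trichotomy i j with h | rfl | h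
    · exact ((hp i j h).2.2 ((hmemR i j h).2 hij) (hdisR i j h hij)).2
    · exact absurd hij G.irrefl
    · have := ((hp j i h).2.2 ((hmemR j i h).2 hij.symm) (hdisR j i h hij.symm)).2
      rwa [Sym2.eq_swap] at this
end Promise

theorem infinite_of_hensonExtProp {V : Type} {H : SimpleGraph V} (hH : HensonExtProp H) :
    Infinite V := by
  refine ⟨fun hfin => ?_⟩
  have := Fintype.ofFinite V
  obtain ⟨v, -, hv, -⟩ := hH ∅ Finset.univ (Finset.disjoint_empty_left _) (by simp)
  exact hv (Finset.mem_univ v)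

theorem exists_copy_two_colors {V κ : Type} [Countable V] [Finite κ] {H : SimpleGraph V}
    (hTF : H.CliqueFree 3) (hH : HensonExtProp H) (c : Sym2 V → κ) :
    ∃ W : Set V, Nonempty (H ≃g H.induce W) ∧ ∃ ε₁ ε₂ : κ, ∀ e ∈ H.edgeSet,
      (∀ v ∈ e, v ∈ W) → c e = ε₁ ∨ c e = ε₂ := by
  have := infinite_of_hensonExtProp hH
  obtain ⟨φ⟩ := nonempty_equiv_of_countable (α := ℕ) (β := V)
  let ψ : H.comap φ ≃g H := SimpleGraph.Iso.comap φ H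
  obtain ⟨e, w, hw⟩ := Promise.exists_embedding hH c (H.comap φ)
    (hTF.comap ψ.toEmbedding.isContained)
  refine ⟨Set.range w, ⟨ψ.symm.trans ⟨Equiv.ofInjective w w.injective, w.map_rel_iff⟩⟩,
    e.1, e.2, fun z => ?_⟩
  induction z using Sym2.ind with
  | _ a b =>
    intro hz hzW
    obtain ⟨i, rfl⟩ := hzW _ (Sym2.mem_mk_left _ _)
    obtain ⟨j, rfl⟩ := hzW _ (Sym2.mem_mk_right _ _)
    exact hw i j (w.map_rel_iff.1 hz)

/-- Along the edge `xy`, the values of `f` and `g` increase in the same direction. -/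
def Agree {V : Type*} (f g : V → ℕ) (x y : V) : Prop :=
  f x < f y ∧ g x < g y ∨ f y < f x ∧ g y < g x

open Classical in
/-- The edge coloring that records whether `f` and `g` increase in the same direction. -/
noncomputable def agreeColoring {V : Type*} (f g : V → ℕ) : Sym2 V → Fin 2 :=
  Sym2.lift ⟨fun x y => if Agree f g x y then 0 else 1, fun _ _ =>
    if_congr or_comm rfl rfl⟩

theorem exists_coloring_both {V : Type} [Countable V] {H : SimpleGraph V}
    (hTF : H.CliqueFree 3) (hH : HensonExtProp H) :
    ∃ c : Sym2 V → Fin 2, ∀ W : Set V, Nonempty (H ≃g H.induce W) →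
      (∃ e ∈ H.edgeSet, (∀ v ∈ e, v ∈ W) ∧ c e = 0) ∧
      (∃ e ∈ H.edgeSet, (∀ v ∈ e, v ∈ W) ∧ c e = 1) := by
  classical
  obtain ⟨idx, hidx⟩ := exists_injective_nat V
  have hnbr : ∀ x, ∃ k, ∃ y, H.Adj x y ∧ idx y = k := by
    intro x
    obtain ⟨y, -, -, hy, -⟩ := hH {x} ∅ (Finset.disjoint_empty_right _) (by simp)
    exact ⟨_, y, (hy x (Finset.mem_singleton_self x)).symm, rfl⟩
  let fn : V → ℕ := fun x => Nat.find (hnbr x)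
  have hfn : ∀ x, ∃ y, H.Adj x y ∧ idx y = fn x := fun x => Nat.find_spec (hnbr x)
  have hle : ∀ x y, H.Adj x y → fn x ≤ idx y := fun x y h => Nat.find_min' (hnbr x) ⟨y, h, rfl⟩
  have htri : ∀ a b d, H.Adj a b → H.Adj a d → ¬ H.Adj b d := fun a b d h1 h2 h3 =>
    hTF {a, b, d} (SimpleGraph.is3Clique_triple_iff.2 ⟨h1, h2, h3⟩)
  have hne : ∀ x y, H.Adj x y → fn x ≠ fn y := by
    intro x y h he
    obtain ⟨a, ha, hax⟩ := hfn x
    obtain ⟨b, hb, hby⟩ := hfn y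
    obtain rfl : a = b := hidx (by rw [hax, hby, he])
    exact htri x y a h ha hb
  refine ⟨agreeColoring idx fn, fun W ⟨φ⟩ => ?_⟩
  let f : V → V := fun v => (φ v).1
  have hfW : ∀ v, f v ∈ W := fun v => (φ v).2
  have hfinj : Function.Injective f := Subtype.val_injective.comp φ.injective
  have hadj : ∀ {x y}, H.Adj x y → H.Adj (f x) (f y) := fun h => φ.map_adj_iff.2 h
  have hext : ∀ a b n, ¬ H.Adj a b → ∃ y, H.Adj y a ∧ H.Adj y b ∧ n < idx (f y) := by
    intro a b n hab
    have hfin : {v | idx (f v) ≤ n}.Finite :=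
      (Set.finite_Iic n).preimage (hidx.comp hfinj).injOn
    obtain ⟨y, hy1, hy2, hy3, -⟩ := hH {a, b} (hfin.toFinset \ {a, b}) Finset.disjoint_sdiff
      (by simp [hab, H.adj_comm b a])
    refine ⟨y, hy3 a (by simp), hy3 b (by simp), not_le.1 fun hn => hy2 ?_⟩
    exact Finset.mem_sdiff.2 ⟨hfin.mem_toFinset.2 hn, hy1⟩
  have hmem : ∀ x y, ∀ v ∈ s(f x, f y), v ∈ W := by
    intro x y v hv
    rcases Sym2.mem_iff.1 hv with rfl | rfl
    exacts [hfW x, hfW y]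
  constructor
  · obtain ⟨v⟩ := (infinite_of_hensonExtProp hH).nonempty
    obtain ⟨a, -, ha⟩ := exists_minimalFor_of_wellFoundedLT (fun _ : V => True) (fn ∘ f)
      ⟨v, trivial⟩
    obtain ⟨y, hya, -, hy⟩ := hext a a (idx (f a)) H.irrefl
    refine ⟨s(f a, f y), hadj hya.symm, hmem a y, if_pos (Or.inl ⟨hy, ?_⟩)⟩
    rcases (hne _ _ (hadj hya)).lt_or_gt with h | h
    · exact absurd (ha trivial h.le) (not_le.2 h)
    · exact h
  · have hone : ∀ x y, H.Adj x y → idx (f x) < idx (f y) → fn (f y) < fn (f x) →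
        ∃ e ∈ H.edgeSet, (∀ v ∈ e, v ∈ W) ∧ agreeColoring idx fn e = 1 := by
      intro x y h h1 h2
      refine ⟨s(f x, f y), hadj h, hmem x y, if_neg ?_⟩
      rintro (h | h)
      exacts [h2.not_gt h.2, h1.not_gt h.1]
    obtain ⟨x₀⟩ := (infinite_of_hensonExtProp hH).nonempty
    obtain ⟨y, hy, hymax⟩ : ∃ y, H.Adj x₀ y ∧ ∀ y', H.Adj x₀ y' → fn (f y') ≤ fn (f y) := by
      obtain ⟨y₀, hy₀, -⟩ := hext x₀ x₀ 0 H.irrefl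
      have hfin : ((fun y => fn (f y)) '' {y | H.Adj x₀ y}).Finite :=
        (Set.finite_Iic (idx (f x₀))).subset (by
          rintro _ ⟨y, hy, rfl⟩
          exact hle _ _ (hadj hy).symm)
      obtain ⟨_, ⟨y, hy, rfl⟩, hmax⟩ := hfin.exists_maximal ⟨_, y₀, hy₀.symm, rfl⟩
      refine ⟨y, hy, fun y' hy' => ?_⟩
      by_contra! hlt
      exact absurd (hmax ⟨y', hy', rfl⟩ hlt.le) (not_le.2 hlt)
    obtain ⟨z, hzy, -, hz⟩ := hext y y (idx (f y)) H.irrefl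
    rcases (hne _ _ (hadj hzy)).lt_or_gt with h | h
    · exact hone y z hzy.symm hz h
    · obtain ⟨y', hyx, hyz, hy'⟩ := hext x₀ z (idx (f z)) (htri y x₀ z hy.symm hzy.symm)
      exact hone z y' hyz.symm hy' ((hymax y' hyx.symm).trans_lt h)

end TriangleFreeRamsey

/-- **Sauer.** Let `H₃` be a universal triangle-free graph.  (a) For every finite coloring
of the edges of `H₃` there is an induced subgraph of `H₃` isomorphic to `H₃` whose edges
take at most two colors.  (b) There is a coloring of the edges of `H₃` into two colors such
that every induced subgraph of `H₃` isomorphic to `H₃` has edges of both colors. -/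
theorem sauer_edge_coloring {V : Type} [Countable V] (H : SimpleGraph V)
    (hTF : H.CliqueFree 3) (hH : HensonExtProp H) :
    (∀ (k : ℕ) (c : Sym2 V → Fin (k + 1)),
      ∃ W : Set V, Nonempty (H ≃g H.induce W) ∧
        ∃ ε₁ ε₂ : Fin (k + 1), ∀ e ∈ H.edgeSet, (∀ v ∈ e, v ∈ W) →
          c e = ε₁ ∨ c e = ε₂) ∧
    (∃ c : Sym2 V → Fin 2,
      ∀ W : Set V, Nonempty (H ≃g H.induce W) →
        (∃ e ∈ H.edgeSet, (∀ v ∈ e, v ∈ W) ∧ c e = 0) ∧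
        (∃ e ∈ H.edgeSet, (∀ v ∈ e, v ∈ W) ∧ c e = 1)) := by
  exact ⟨fun _ c => TriangleFreeRamsey.exists_copy_two_colors hTF hH c,
    TriangleFreeRamsey.exists_coloring_both hTF hH⟩
end

section
/- (Dobrinen) The universal triangle-free graph has finite big Ramsey degrees: for every finite triangle-free graph G there is a positive integer n(G) such that for every universal triangle-free graph H₃ and every coloring of the set of induced subgraphs of H₃ isomorphic to G into finitely many colors, there is an induced subgraph H of H₃ isomorphic to H₃ such that the induced subgraphs of H isomorphic to G take no more than n(G) colors. -/
open Filter Set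

/-- A surjection of `ℕ` onto itself whose values occur for the first time in increasing order.
Such maps are the infinite parameter words over the empty alphabet. -/
structure Rigid (A : ℕ → ℕ) : Prop where
  exists_lt : ∀ i v, v < A i → ∃ j < i, A j = v
  surjective : Function.Surjective A

/-- `A` fixes the first `m` natural numbers. -/
def FixesBelow (m : ℕ) (A : ℕ → ℕ) : Prop := ∀ i < m, A i = i

/-- `N` is the first position at which `A` takes the value `k`, and only values below `k` occur
before it. -/
def FirstAt (k : ℕ) (A : ℕ → ℕ) (N : ℕ) : Prop := A N = k ∧ ∀ i < N, A i < k

namespace Rigid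

theorem id : Rigid id := ⟨fun _ v hv => ⟨v, hv, rfl⟩, Function.surjective_id⟩

theorem comp {A B : ℕ → ℕ} (hA : Rigid A) (hB : Rigid B) : Rigid (A ∘ B) := by
  refine ⟨fun i v hv => ?_, hA.surjective.comp hB.surjective⟩
  obtain ⟨j, hj, rfl⟩ := hA.exists_lt _ _ hv
  obtain ⟨l, hl, rfl⟩ := hB.exists_lt _ _ hj
  exact ⟨l, hl, rfl⟩

theorem le_self {A : ℕ → ℕ} (hA : Rigid A) (i : ℕ) : A i ≤ i := by
  induction i using Nat.strong_induction_on with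
  | _ i ih =>
    rcases Nat.eq_zero_or_pos (A i) with h | h
    · omega
    · obtain ⟨j, hj, hj'⟩ := hA.exists_lt i (A i - 1) (by omega)
      have := ih j hj
      omega

theorem exists_firstAt {A : ℕ → ℕ} (hA : Rigid A) (k : ℕ) : ∃ N, FirstAt k A N := by
  classical
  refine ⟨Nat.find (hA.surjective k), Nat.find_spec (hA.surjective k), fun i hi => ?_⟩
  by_contra! h
  rcases h.eq_or_lt with h | h
  · exact Nat.find_min (hA.surjective k) hi h.symm
  · obtain ⟨j, hj, hj'⟩ := hA.exists_lt i k h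
    exact Nat.find_min (hA.surjective k) (hj.trans hi) hj'

end Rigid

theorem FirstAt.comp {A B : ℕ → ℕ} {k l N : ℕ} (hA : FirstAt k A l) (hB : FirstAt l B N) :
    FirstAt k (A ∘ B) N :=
  ⟨by simp [hB.1, hA.1], fun i hi => hA.2 _ (hB.2 i hi)⟩

theorem FixesBelow.comp {A B : ℕ → ℕ} {m : ℕ} (hA : FixesBelow m A) (hB : FixesBelow m B) :
    FixesBelow m (A ∘ B) := fun i hi => by simp [hB i hi, hA i hi]

theorem FixesBelow.mono {A : ℕ → ℕ} {m n : ℕ} (hA : FixesBelow n A) (h : m ≤ n) :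
    FixesBelow m A := fun i hi => hA i (hi.trans_le h)

theorem FirstAt.le {A : ℕ → ℕ} {m N : ℕ} (hA : FirstAt m A N) (hm : FixesBelow m A) :
    m ≤ N := by
  by_contra! h
  have := hm N h
  have := hA.1
  omega

theorem FirstAt.comp_of_fixesBelow {A Y : ℕ → ℕ} {m N : ℕ} (hA : FirstAt m A N)
    (hY : FixesBelow (N + 1) Y) : FirstAt m (A ∘ Y) N :=
  ⟨by simp [hY N (by omega), hA.1], fun i hi => by simp [hY i (by omega), hA.2 i hi]⟩

/-- The composition `X (k - 1) ∘ ⋯ ∘ X 1 ∘ X 0`. -/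
def compSeq (X : ℕ → ℕ → ℕ) : ℕ → ℕ → ℕ
  | 0 => id
  | k + 1 => X k ∘ compSeq X k

theorem Rigid.compSeq {X : ℕ → ℕ → ℕ} (hX : ∀ k, Rigid (X k)) (k : ℕ) :
    Rigid (compSeq X k) := by
  induction k with
  | zero => exact Rigid.id
  | succ k ih => exact (hX k).comp ih

/-- Infinite compositions of rigid surjections fixing longer and longer initial segments
converge pointwise to a rigid surjection. -/
theorem exists_rigid_limit {m : ℕ} {X : ℕ → ℕ → ℕ} (hX : ∀ k, Rigid (X k))
    (hfix : ∀ k, FixesBelow (m + k + 1) (X k)) :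
    ∃ Y, Rigid Y ∧ FixesBelow (m + 1) Y ∧ ∀ i k, i ≤ k → compSeq X k i = Y i := by
  have stable : ∀ i k, i ≤ k → compSeq X k i = compSeq X i i := by
    intro i k hik
    induction k, hik using Nat.le_induction with
    | base => rfl
    | succ k hk ih =>
      have h := (Rigid.compSeq hX k).le_self i
      rw [← ih]
      exact hfix k _ (by omega)
  refine ⟨fun i => compSeq X i i, ⟨fun i v hv => ?_, fun v => ?_⟩, fun i hi => ?_, stable⟩
  · obtain ⟨j, hj, hj'⟩ := (Rigid.compSeq hX i).exists_lt i v hv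
    exact ⟨j, hj, by rw [← stable j i hj.le]; exact hj'⟩
  · obtain ⟨i, hi⟩ := (Rigid.compSeq hX v).surjective v
    have h : ∀ k, v ≤ k → compSeq X k i = v := by
      intro k hk
      induction k, hk using Nat.le_induction with
      | base => exact hi
      | succ k hk ih =>
        change X k (compSeq X k i) = v
        rw [ih]
        exact hfix k _ (by omega)
    exact ⟨i, by
      rw [← stable i (max i v) (le_max_left _ _)]; exact h _ (le_max_right _ _)⟩
  · have h : ∀ k, compSeq X k i = i := by
      intro k
      induction k with
      | zero => rfl
      | succ k ih =>
        change X k (compSeq X k i) = i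
        rw [ih]
        exact hfix k _ (by omega)
    exact h i

/-- The fusion lemma: a construction refining rigid surjections step by step, each step fixing
more initial values, has a limit refining all stages. -/
theorem exists_fusion {m : ℕ} (P : ℕ → (ℕ → ℕ) → Prop) {W₀ : ℕ → ℕ} (hW₀ : Rigid W₀)
    (h₀ : P 0 W₀)
    (step : ∀ n W, Rigid W → P n W →
      ∃ X, Rigid X ∧ FixesBelow (m + n + 1) X ∧ P (n + 1) (X ∘ W)) :
    ∃ W, Rigid W ∧ ∀ n, ∃ V Y, Rigid V ∧ Rigid Y ∧ FixesBelow (m + n + 1) Y ∧ P n V ∧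
      W = Y ∘ V := by
  choose! X hX hfix hP using step
  let V : ℕ → ℕ → ℕ := fun n => Nat.rec W₀ (fun n W => X n W ∘ W) n
  have hV : ∀ n, Rigid (V n) ∧ P n (V n) := by
    intro n
    induction n with
    | zero => exact ⟨hW₀, h₀⟩
    | succ n ih => exact ⟨(hX n _ ih.1 ih.2).comp ih.1, hP n _ ih.1 ih.2⟩
  have hlim : ∀ n, ∃ Y, Rigid Y ∧ FixesBelow (m + n + 1) Y ∧
      ∀ i k, i ≤ k → compSeq (fun k => X (n + k) (V (n + k))) k i = Y i := by
    intro n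
    refine exists_rigid_limit (fun k => hX _ _ (hV _).1 (hV _).2) fun k => ?_
    have := hfix (n + k) _ (hV _).1 (hV _).2
    rwa [← add_assoc] at this
  choose Y hY hYfix hYlim using hlim
  have hcomp : ∀ n k, compSeq (fun k => X (n + k) (V (n + k))) k ∘ V n = V (n + k) := by
    intro n k
    induction k with
    | zero => rfl
    | succ k ih =>
      change X (n + k) (V (n + k)) ∘ (compSeq (fun k => X (n + k) (V (n + k))) k ∘ V n) = _
      rw [ih]
      rfl
  have heval : ∀ n i k, V n i ≤ k → Y n (V n i) = V (n + k) i := by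
    intro n i k hk
    rw [← hYlim n _ k hk, ← hcomp n k]
    rfl
  refine ⟨Y 0 ∘ V 0, (hY 0).comp (hV 0).1, fun n =>
    ⟨V n, Y n, (hV n).1, hY n, hYfix n, (hV n).2, funext fun i => ?_⟩⟩
  change Y 0 (V 0 i) = Y n (V n i)
  rw [heval 0 i (n + (V n i + V 0 i)) (by omega), heval n i (V n i + V 0 i) (by omega), zero_add]

/-- The map inserting the word `z` at position `p` into the identity. -/
def insertWord (p : ℕ) (z : List ℕ) (i : ℕ) : ℕ :=
  if i < p then i else (z[i - p]?).getD (i - z.length)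

theorem insertWord_of_lt {p : ℕ} {z : List ℕ} {i : ℕ} (h : i < p) : insertWord p z i = i := by
  simp [insertWord, h]

theorem insertWord_add {p : ℕ} {z : List ℕ} {i : ℕ} (h : i < z.length) :
    insertWord p z (p + i) = z[i] := by
  simp [insertWord, h]

theorem insertWord_add_length {p : ℕ} {z : List ℕ} (i : ℕ) :
    insertWord p z (p + z.length + i) = p + i := by
  have h : z[p + z.length + i - p]? = none := by
    rw [List.getElem?_eq_none_iff]
    omega
  rw [insertWord, if_neg (by omega), h]
  simp only [Option.getD_none]
  omega

theorem fixesBelow_insertWord (p : ℕ) (z : List ℕ) : FixesBelow p (insertWord p z) :=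
  fun _ => insertWord_of_lt

theorem rigid_insertWord {p : ℕ} {z : List ℕ} (hz : ∀ a ∈ z, a < p) :
    Rigid (insertWord p z) := by
  refine ⟨fun i v hv => ?_, fun v => ?_⟩
  · rcases lt_or_ge i p with hi | hi
    · rw [insertWord_of_lt hi] at hv
      exact ⟨v, hv, insertWord_of_lt (by omega)⟩
    obtain ⟨i, rfl⟩ := Nat.exists_eq_add_of_le hi
    rcases lt_or_ge i z.length with hl | hl
    · rw [insertWord_add hl] at hv
      have := hz _ (List.getElem_mem hl)
      exact ⟨v, by omega, insertWord_of_lt (by omega)⟩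
    obtain ⟨i, rfl⟩ := Nat.exists_eq_add_of_le hl
    rw [← add_assoc, insertWord_add_length] at hv
    rcases lt_or_ge v p with h | h
    · exact ⟨v, by omega, insertWord_of_lt h⟩
    · obtain ⟨v, rfl⟩ := Nat.exists_eq_add_of_le h
      exact ⟨p + z.length + v, by omega, insertWord_add_length v⟩
  · rcases lt_or_ge v p with h | h
    · exact ⟨v, insertWord_of_lt h⟩
    · obtain ⟨v, rfl⟩ := Nat.exists_eq_add_of_le h
      exact ⟨p + z.length + v, insertWord_add_length v⟩
section Ultrafilters

attribute [local instance] Ultrafilter.mul Ultrafilter.semigroup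

theorem Ultrafilter.map_mul_of_mulHom {M N F : Type*} [Mul M] [Mul N] [FunLike F M N]
    [MulHomClass F M N] (f : F) (U V : Ultrafilter M) :
    (U * V).map f = U.map f * V.map f := by
  refine Ultrafilter.coe_inj.mp (Filter.ext' fun p => ?_)
  rw [Ultrafilter.eventually_mul]
  simp only [Ultrafilter.coe_map, Filter.eventually_map]
  rw [Ultrafilter.eventually_mul]
  simp only [map_mul]

/-- The semigroup of ultrafilters on a semigroup has a minimal left ideal, that is, a left ideal
generated by each of its elements. -/
theorem Ultrafilter.exists_minimal_leftIdeal (M : Type*) [Semigroup M] [Nonempty M] :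
    ∃ L : Set (Ultrafilter M), L.Nonempty ∧ (∀ U, ∀ p ∈ L, U * p ∈ L) ∧
      ∀ p ∈ L, ∀ q ∈ L, ∃ U, U * p = q := by
  let S : Set (Set (Ultrafilter M)) :=
    {L | IsClosed L ∧ L.Nonempty ∧ ∀ U, ∀ p ∈ L, U * p ∈ L}
  obtain ⟨L, hL⟩ : ∃ L, Minimal (· ∈ S) L := by
    refine zorn_superset _ fun c hcs hc => ?_
    refine ⟨⋂₀ c, ⟨isClosed_sInter fun t ht => (hcs ht).1, ?_, fun U p hp t ht =>
      (hcs ht).2.2 U p (hp t ht)⟩, fun s hs => sInter_subset_of_mem hs⟩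
    obtain rfl | hcnemp := c.eq_empty_or_nonempty
    · rw [sInter_empty]
      exact univ_nonempty
    · have := hcnemp.to_subtype
      rw [sInter_eq_iInter]
      exact IsCompact.nonempty_iInter_of_directed_nonempty_isCompact_isClosed _
        (DirectedOn.directed_val (IsChain.directedOn hc.symm)) (fun i => (hcs i.2).2.1)
        (fun i => (hcs i.2).1.isCompact) (fun i => (hcs i.2).1)
  refine ⟨L, hL.prop.2.1, hL.prop.2.2, fun p hp q hq => ?_⟩
  have hmem : range (fun U => U * p) ∈ S := by
    refine ⟨(isCompact_range (Ultrafilter.continuous_mul_left p)).isClosed, range_nonempty _, ?_⟩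
    rintro U _ ⟨V, rfl⟩
    exact ⟨U * V, mul_assoc _ _ _⟩
  have hsub : range (fun U => U * p) ⊆ L := by
    rintro _ ⟨U, rfl⟩
    exact hL.prop.2.2 U p hp
  exact hL.le_of_le hmem hsub hq

/-- The substitution of the letter `a` for the variable `none`. -/
def substVar {σ : Type*} (a : σ) : FreeMonoid (Option σ) →* FreeMonoid σ :=
  FreeMonoid.map fun o => o.getD a

theorem substVar_map_some {σ : Type*} (a : σ) (x : FreeMonoid σ) :
    substVar a (FreeMonoid.map some x) = x := by
  rw [substVar, FreeMonoid.map_map]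
  exact DFunLike.congr_fun FreeMonoid.map_id x

/-- There is an ultrafilter on left variable words whose instances under substitution form a
left zero semigroup. -/
theorem exists_leftVariable_ultrafilter (σ : Type*) :
    ∃ r : Ultrafilter (FreeMonoid (Option σ)),
      (∀ᶠ x in (r : Filter (FreeMonoid (Option σ))), ∃ y, x = FreeMonoid.of none * y) ∧
      ∀ a b : σ, r.map (substVar a) * r.map (substVar b) = r.map (substVar a) := by
  obtain ⟨L, ⟨p, hp⟩, hideal, hmin⟩ := Ultrafilter.exists_minimal_leftIdeal (FreeMonoid σ)
  let e : Ultrafilter (FreeMonoid (Option σ)) := p.map (FreeMonoid.map some)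
  let v : FreeMonoid (Option σ) := FreeMonoid.of none
  let f : Ultrafilter (FreeMonoid (Option σ)) → Ultrafilter (FreeMonoid (Option σ)) :=
    fun U => (U * e).map (v * ·)
  have hf : ∀ U, f U = pure v * (U * e) := fun U => by
    refine Ultrafilter.coe_inj.mp (Filter.ext' fun q => ?_)
    rw [Ultrafilter.eventually_mul]
    simp [f]
  have hmap : Continuous (Ultrafilter.map (v * ·)) :=
    ultrafilterBasis_is_basis.continuous_iff.2 <| Set.forall_mem_range.mpr fun s =>
      ultrafilter_isOpen_basic ((v * ·) ⁻¹' s)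
  have hcont : Continuous f := hmap.comp (Ultrafilter.continuous_mul_left e)
  obtain ⟨r, ⟨U, rfl⟩, hr⟩ := exists_idempotent_in_compact_subsemigroup
    Ultrafilter.continuous_mul_left (range f) ⟨f e, e, rfl⟩ (isCompact_range hcont) (by
      rintro _ ⟨U, rfl⟩ _ ⟨V, rfl⟩
      refine ⟨U * e * pure v * V, ?_⟩
      simp only [hf, mul_assoc])
  have hL : ∀ a, (f U).map (substVar a) ∈ L := by
    intro a
    have he : e.map (substVar a) = p := by
      change (p.map _).map _ = p
      rw [Ultrafilter.map_map]
      convert Ultrafilter.map_id p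
      exact funext fun x => substVar_map_some a x
    rw [hf, Ultrafilter.map_mul_of_mulHom, Ultrafilter.map_mul_of_mulHom, he]
    exact hideal _ _ (hideal _ _ hp)
  refine ⟨f U, Filter.eventually_map.2 (Eventually.of_forall fun x => ⟨x, rfl⟩), fun a b => ?_⟩
  obtain ⟨l, hl⟩ := hmin _ (hL b) _ (hL a)
  rw [← hl, mul_assoc, ← Ultrafilter.map_mul_of_mulHom, hr]

/-- The one-step form of the Carlson–Simpson theorem: beyond every word `s₀` there is a
monochromatic family of words such that any finitely many of them can be extended simultaneously
by the instances of a left variable word. -/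
theorem exists_extendable_words {σ κ : Type*} [Finite σ] [Nonempty σ] [Finite κ]
    (c : List σ → κ) (s₀ : List σ) :
    ∃ (Good : Set (List σ)) (k : κ), (∀ s ∈ Good, c s = k) ∧ (∃ s, s₀ ++ s ∈ Good) ∧
      ∀ F ⊆ Good, F.Finite → ∃ y : List (Option σ), ∀ s ∈ F, ∀ a : σ,
        s ++ a :: y.map (fun o => o.getD a) ∈ Good := by
  obtain ⟨r, hvar, hr⟩ := exists_leftVariable_ultrafilter σ
  obtain ⟨a₀⟩ := ‹Nonempty σ›
  let C : FreeMonoid σ → κ := fun s => c s.toList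
  let w₀ : FreeMonoid σ := FreeMonoid.ofList s₀
  have hsub : ∀ (a b : σ) (q : FreeMonoid σ → Prop),
      (∀ᶠ x in r, q (substVar a x)) ↔
        ∀ᶠ x in r, ∀ᶠ y in r, q (substVar a x * substVar b y) := by
    intro a b q
    have h : (∀ᶠ t in (r.map (substVar a) * r.map (substVar b) : Ultrafilter _), q t) ↔
        ∀ᶠ t in (r.map (substVar a) : Ultrafilter _), q t := by rw [hr]
    rw [Ultrafilter.eventually_mul] at h
    simpa only [Ultrafilter.coe_map, Filter.eventually_map] using h.symm
  obtain ⟨k, hk⟩ : ∃ k, ∀ᶠ x in r, C (w₀ * substVar a₀ x) = k := by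
    have h : ∀ᶠ x in r, ∃ k, C (w₀ * substVar a₀ x) = k := Eventually.of_forall fun x => ⟨_, rfl⟩
    exact Ultrafilter.eventually_exists_iff.mp h
  let Good : Set (FreeMonoid σ) :=
    {s | C s = k ∧ ∀ a, ∀ᶠ x in r, C (s * substVar a x) = k}
  refine ⟨{s | FreeMonoid.ofList s ∈ Good}, k, fun s hs => hs.1, ?_, fun F hF hfin => ?_⟩
  · have h : ∀ᶠ x in r, w₀ * substVar a₀ x ∈ Good := by
      refine hk.and (eventually_all.2 fun a => ?_)
      have := (hsub a₀ a fun t => C (w₀ * t) = k).1 hk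
      simpa only [mul_assoc] using this
    obtain ⟨x, hx⟩ := h.exists
    exact ⟨(substVar a₀ x).toList, hx⟩
  · have h : ∀ s ∈ F, ∀ a, ∀ᶠ x in r, FreeMonoid.ofList s * substVar a x ∈ Good := by
      intro s hs a
      refine ((hF hs).2 a).and (eventually_all.2 fun b => ?_)
      have := (hsub a b fun t => C (FreeMonoid.ofList s * t) = k).1 ((hF hs).2 a)
      simpa only [mul_assoc] using this
    have h' : ∀ᶠ x in r, ∀ s ∈ F, ∀ a, FreeMonoid.ofList s * substVar a x ∈ Good :=
      (eventually_all_finite hfin).2 fun s hs => eventually_all.2 fun a => h s hs a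
    obtain ⟨_, hx, y, rfl⟩ := (h'.and hvar).exists
    exact ⟨y.toList, hx⟩

end Ultrafilters

/-- On rigid surjections fixing `0, …, m - 1`, the coloring `c` depends only on the part before
the first occurrence of `k`. -/
def DeterminedBefore {κ : Type} (m k : ℕ) (c : (ℕ → ℕ) → κ) : Prop :=
  ∀ A B, Rigid A → Rigid B → FixesBelow m A → FixesBelow m B →
    ∀ N, FirstAt k A N → FirstAt k B N → (∀ i < N, A i = B i) → c A = c B

theorem DeterminedBefore.comp {κ : Type} {m m' k : ℕ} {c : (ℕ → ℕ) → κ}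
    (hc : DeterminedBefore m k c) {V : ℕ → ℕ} (hV : Rigid V) (hm : m ≤ m')
    (hfix : FixesBelow m V) : DeterminedBefore m' k fun A => c (A ∘ V) := by
  intro A B hA hB hAm hBm N hAN hBN hAB
  obtain ⟨l, hl⟩ := hV.exists_firstAt N
  exact hc _ _ (hA.comp hV) (hB.comp hV) ((hAm.mono hm).comp hfix) ((hBm.mono hm).comp hfix) l
    (hAN.comp hl) (hBN.comp hl) fun i hi => hAB _ (hl.2 i hi)

theorem map_range_insertWord_comp {α : Type*} {W : ℕ → ℕ} {N p : ℕ} (y : List ℕ)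
    (hlt : ∀ j < N, W j < p) (hge : ∀ i, W (N + i) = p + i) (f : ℕ → α) :
    (List.range (N + 1 + y.length)).map (fun i => f (insertWord (p + 1) y (W i))) =
      (List.range N).map (fun i => f (W i)) ++ f p :: y.map f := by
  rw [add_assoc, List.range_add, List.map_append, List.map_map]
  congr 1
  · refine List.map_congr_left fun i hi => ?_
    rw [insertWord_of_lt (by have := hlt i (List.mem_range.1 hi); omega)]
  · rw [add_comm 1, List.range_succ_eq_map, List.map_cons, List.map_map]
    congr 1
    · have h := hge 0
      simp only [add_zero] at h
      simp [h, insertWord_of_lt]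
    · refine List.ext_getElem (by simp) fun i h₁ h₂ => ?_
      simp only [List.length_map, List.length_range] at h₁
      simp only [List.getElem_map, List.getElem_range, Function.comp_apply, hge]
      rw [show p + i.succ = p + 1 + i by omega, insertWord_add h₁]

/-- The Carlson–Simpson theorem for words without parameters. -/
theorem exists_monochromatic_words {κ : Type} [Finite κ] {m : ℕ} (hm : 1 ≤ m)
    (c : (ℕ → ℕ) → κ) (hc : DeterminedBefore m m c) :
    ∃ W, Rigid W ∧ FixesBelow m W ∧ ∃ k, ∀ A, Rigid A → FixesBelow m A → c (A ∘ W) = k := by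
  classical
  have : Nonempty (Fin m) := ⟨⟨0, hm⟩⟩
  let letter : ℕ → Fin m := fun i => if h : i < m then ⟨i, h⟩ else ⟨0, hm⟩
  have hletter : ∀ i < m, (letter i : ℕ) = i := fun i hi => by simp [letter, hi]
  let Codes : List (Fin m) → (ℕ → ℕ) → Prop := fun l A => Rigid A ∧ FixesBelow m A ∧
    ∃ N, FirstAt m A N ∧ l = (List.range N).map fun i => letter (A i)
  let c' : List (Fin m) → κ := fun l => if h : ∃ A, Codes l A then c h.choose else c id
  have hc' : ∀ l A, Codes l A → c' l = c A := by
    intro l A hA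
    have h : ∃ A, Codes l A := ⟨A, hA⟩
    simp only [c', dif_pos h]
    obtain ⟨hB, hBm, N, hBN, hBl⟩ := h.choose_spec
    obtain ⟨hA, hAm, M, hAM, hAl⟩ := hA
    have hlen := congrArg List.length (hBl.symm.trans hAl)
    simp only [List.length_map, List.length_range] at hlen
    subst hlen
    refine hc _ _ hB hA hBm hAm N hBN hAM fun i hi => ?_
    have h' := List.map_inj_left.1 (hBl.symm.trans hAl) i (List.mem_range.2 hi)
    rw [← hletter _ (hBN.2 i hi), h', hletter _ (hAM.2 i hi)]
  obtain ⟨Good, k, hGood, ⟨w, hw⟩, hext⟩ :=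
    exists_extendable_words c' ((List.range m).map letter)
  let P : ℕ → (ℕ → ℕ) → Prop := fun n W => FixesBelow m W ∧ ∃ N,
    (∀ j < N, W j < m + n) ∧ (∀ i, W (N + i) = m + n + i) ∧
      ∀ A, FixesBelow m A → (∀ i < m + n, A i < m) →
        (List.range N).map (fun i => letter (A (W i))) ∈ Good
  have hw' : ∀ a ∈ w.map Fin.val, a < m := by
    intro a ha
    obtain ⟨b, -, rfl⟩ := List.mem_map.1 ha
    exact b.2
  have h₀ : P 0 (insertWord m (w.map Fin.val)) := by
    refine ⟨fixesBelow_insertWord _ _, m + (w.map Fin.val).length, fun j hj => ?_, fun i => ?_,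
      fun A hA _ => ?_⟩
    · rcases lt_or_ge j m with h | h
      · rw [insertWord_of_lt h]
        exact h
      · obtain ⟨j, rfl⟩ := Nat.exists_eq_add_of_le h
        rw [insertWord_add (by omega)]
        exact hw' _ (List.getElem_mem _)
    · rw [insertWord_add_length]
      rfl
    · convert hw
      rw [List.range_add, List.map_append, List.map_map]
      congr 1
      · refine List.map_congr_left fun i hi => ?_
        rw [insertWord_of_lt (List.mem_range.1 hi), hA i (List.mem_range.1 hi)]
      · refine List.ext_getElem (by simp) fun i h₁ h₂ => ?_
        simp only [List.length_map, List.length_range] at h₁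
        simp only [List.getElem_map, List.getElem_range, Function.comp_apply]
        rw [insertWord_add (by simpa using h₁), List.getElem_map, hA _ (Fin.is_lt _)]
        simp [letter]
  obtain ⟨W, hW, hWP⟩ := exists_fusion (m := m) P (rigid_insertWord hw') h₀ (by
    rintro n W hW ⟨hWm, N, hlt, hge, hWG⟩
    let F : Set (List (Fin m)) := {l | l ∈ Good ∧ l.length = N}
    obtain ⟨y, hy⟩ := hext F (fun l hl => hl.1)
      ((List.finite_length_eq (Fin m) N).subset fun l hl => hl.2)
    let z : List ℕ := y.map fun o => o.elim (m + n) Fin.val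
    have hz : ∀ a ∈ z, a < m + n + 1 := by
      intro a ha
      obtain ⟨o, -, rfl⟩ := List.mem_map.1 ha
      cases o with
      | none => simp
      | some b => exact b.2.trans (by omega)
    refine ⟨insertWord (m + n + 1) z, rigid_insertWord hz, fixesBelow_insertWord _ _,
      ((fixesBelow_insertWord _ _).mono (by omega)).comp hWm, N + 1 + z.length,
      fun j hj => ?_, fun i => ?_, fun A hA hAlt => ?_⟩
    · change insertWord (m + n + 1) z (W j) < m + n + 1
      rcases lt_or_ge j (N + 1) with h | h
      · have : W j < m + n + 1 := by
          rcases lt_or_ge j N with h' | h'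
          · have := hlt j h'
            omega
          · have := hge 0
            rw [show j = N + 0 by omega]
            omega
        rwa [insertWord_of_lt this]
      · obtain ⟨j, rfl⟩ := Nat.exists_eq_add_of_le h
        rw [add_assoc N, hge, ← add_assoc, insertWord_add (by omega)]
        exact hz _ (List.getElem_mem _)
    · change insertWord (m + n + 1) z (W _) = _
      rw [show N + 1 + z.length + i = N + (1 + z.length + i) by omega, hge,
        show m + n + (1 + z.length + i) = m + n + 1 + z.length + i by omega,
        insertWord_add_length]
      rfl
    · have hpre : (List.range N).map (fun i => letter (A (W i))) ∈ F :=
        ⟨hWG A hA fun i hi => hAlt i (by omega), by simp⟩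
      have := hy _ hpre (letter (A (m + n)))
      have hmap := map_range_insertWord_comp z hlt hge fun i => letter (A i)
      change (List.range (N + 1 + z.length)).map
        (fun i => letter (A (insertWord (m + n + 1) z (W i)))) ∈ Good
      rw [hmap]
      convert this using 3
      rw [List.map_map]
      refine List.map_congr_left fun o _ => ?_
      cases o with
      | none => simp
      | some b =>
        simp only [Function.comp_apply, Option.elim_some, Option.getD_some]
        rw [hA _ b.2]
        simp [letter])
  refine ⟨W, hW, ?_, k, fun A hA hAm => ?_⟩
  · obtain ⟨V, Y, -, -, hY, ⟨hV, -⟩, rfl⟩ := hWP 0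
    exact (hY.mono (by omega)).comp hV
  · obtain ⟨l, hl⟩ := hA.exists_firstAt m
    obtain ⟨n, rfl⟩ := Nat.exists_eq_add_of_le (hl.le hAm)
    obtain ⟨V, Y, hV, hY, hYfix, ⟨hVm, N, hlt, hge, hG⟩, rfl⟩ := hWP n
    have hAY := hl.comp_of_fixesBelow hYfix
    have hAYm : FixesBelow m (A ∘ Y) := hAm.comp (hYfix.mono (by omega))
    have hVN : FirstAt (m + n) V N := ⟨by simpa using hge 0, hlt⟩
    rw [← hGood _ (hG (A ∘ Y) hAYm hAY.2)]
    exact (hc' _ _ ⟨(hA.comp hY).comp hV, hAYm.comp hVm, N, hAY.comp hVN, rfl⟩).symm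

/-- A rigid surjection whose first occurrence of `m` is at position `m + n` factors through the
insertion of the letters between `m` and `m + n`. -/
theorem exists_eq_comp_insertWord {A : ℕ → ℕ} {m n : ℕ} {z : List ℕ} (hA : Rigid A)
    (hAm : FixesBelow m A) (hN : FirstAt m A (m + n)) (hlen : z.length = n)
    (hz : ∀ i (h : i < z.length), z[i] = A (m + i)) :
    ∃ B, Rigid B ∧ FixesBelow (m + 1) B ∧ A = B ∘ insertWord m z := by
  let B : ℕ → ℕ := fun i => if i < m then i else A (i + n)
  have hBlt : ∀ i < m, B i = i := fun i hi => by simp [B, hi]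
  have hBge : ∀ i, B (m + i) = A (m + n + i) := fun i => by
    simp only [B, if_neg (show ¬ m + i < m by omega)]
    congr 1
    omega
  refine ⟨B, ⟨fun i v hv => ?_, fun v => ?_⟩, fun i hi => ?_, funext fun i => ?_⟩
  · rcases lt_or_ge i m with h | h
    · rw [hBlt i h] at hv
      exact ⟨v, hv, hBlt v (by omega)⟩
    · obtain ⟨i, rfl⟩ := Nat.exists_eq_add_of_le h
      rw [hBge] at hv
      rcases lt_or_ge v m with h' | h'
      · exact ⟨v, by omega, hBlt v h'⟩
      · obtain ⟨j, hj, rfl⟩ := hA.exists_lt _ _ hv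
        have : m + n ≤ j := by
          by_contra! hlt
          have := hN.2 j hlt
          omega
        obtain ⟨j, rfl⟩ := Nat.exists_eq_add_of_le this
        exact ⟨m + j, by omega, hBge j⟩
  · rcases lt_or_ge v m with h' | h'
    · exact ⟨v, hBlt v h'⟩
    · obtain ⟨j, rfl⟩ := hA.surjective v
      have : m + n ≤ j := by
        by_contra! hlt
        have := hN.2 j hlt
        omega
      obtain ⟨j, rfl⟩ := Nat.exists_eq_add_of_le this
      exact ⟨m + j, hBge j⟩
  · rcases lt_or_ge i m with h | h
    · exact hBlt i h
    · have h1 := hBge 0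
      have h2 := hN.1
      rw [show i = m + 0 by omega, h1]
      simpa using h2
  · rw [Function.comp_apply]
    rcases lt_or_ge i m with h | h
    · rw [insertWord_of_lt h, hBlt i h, hAm i h]
    · obtain ⟨i, rfl⟩ := Nat.exists_eq_add_of_le h
      rcases lt_or_ge i z.length with hl | hl
      · rw [insertWord_add hl, hz i hl, hBlt _ (hN.2 _ (by omega))]
      · obtain ⟨i, rfl⟩ := Nat.exists_eq_add_of_le hl
        rw [← add_assoc, insertWord_add_length, hBge, hlen]

/-- Shift a rigid surjection fixing `0, …, m` by `n` places, leaving the letters below `m`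
unchanged. -/
theorem exists_rigid_shift {m : ℕ} (n : ℕ) {Y : ℕ → ℕ} (hY : Rigid Y)
    (hYm : FixesBelow (m + 1) Y) :
    ∃ X, Rigid X ∧ FixesBelow (m + n + 1) X ∧ ∀ z : List ℕ, z.length = n → (∀ a ∈ z, a < m) →
      insertWord m z ∘ X = Y ∘ insertWord m z := by
  let g : ℕ → ℕ := fun y => if y < m then y else y + n
  let X : ℕ → ℕ := fun i => if i < m + n then i else g (Y (i - n))
  have hXlt : ∀ i < m + n, X i = i := fun i hi => by simp [X, hi]
  have hXge : ∀ i, X (m + n + i) = g (Y (m + i)) := fun i => by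
    simp only [X, if_neg (show ¬ m + n + i < m + n by omega)]
    congr 2
    omega
  have hglt : ∀ y < m, g y = y := fun y hy => by simp [g, hy]
  have hgge : ∀ y, m ≤ y → g y = y + n := fun y hy => by simp [g, hy]
  have hYge : ∀ j, m ≤ Y j → m ≤ j := fun j hj => by
    by_contra! h
    have := hYm j (by omega)
    omega
  have hYX : ∀ j, m ≤ Y j → X (j + n) = Y j + n := fun j hj => by
    obtain ⟨j, rfl⟩ := Nat.exists_eq_add_of_le (hYge j hj)
    rw [show m + j + n = m + n + j by omega, hXge, hgge _ hj]
  refine ⟨X, ⟨fun i v hv => ?_, fun v => ?_⟩, fun i hi => ?_, fun z hlen hz => funext fun i => ?_⟩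
  · rcases lt_or_ge i (m + n) with h | h
    · rw [hXlt i h] at hv
      exact ⟨v, hv, hXlt v (by omega)⟩
    · rcases lt_or_ge v (m + n) with h' | h'
      · exact ⟨v, by omega, hXlt v h'⟩
      · obtain ⟨i, rfl⟩ := Nat.exists_eq_add_of_le h
        rw [hXge] at hv
        have hle : m ≤ Y (m + i) := by
          by_contra! hlt
          rw [hglt _ hlt] at hv
          omega
        rw [hgge _ hle] at hv
        obtain ⟨j, hj, hj'⟩ := hY.exists_lt (m + i) (v - n) (by omega)
        exact ⟨j + n, by omega, by rw [hYX j (by omega)]; omega⟩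
  · rcases lt_or_ge v (m + n) with h' | h'
    · exact ⟨v, hXlt v h'⟩
    · obtain ⟨j, hj⟩ := hY.surjective (v - n)
      exact ⟨j + n, by rw [hYX j (by omega)]; omega⟩
  · rcases lt_or_ge i (m + n) with h | h
    · exact hXlt i h
    · have := hYm m (by omega)
      rw [show i = m + n + 0 by omega, hXge, add_zero, this, hgge m le_rfl, add_zero]
  · rw [Function.comp_apply, Function.comp_apply]
    rcases lt_or_ge i m with h | h
    · rw [hXlt i (by omega), insertWord_of_lt h, hYm i (by omega)]
    · obtain ⟨i, rfl⟩ := Nat.exists_eq_add_of_le h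
      rcases lt_or_ge i z.length with hl | hl
      · have := hz _ (List.getElem_mem hl)
        rw [hXlt _ (by omega), insertWord_add hl, hYm _ (by omega)]
      · obtain ⟨i, rfl⟩ := Nat.exists_eq_add_of_le hl
        rw [← add_assoc, insertWord_add_length, hlen, hXge]
        rcases lt_or_ge (Y (m + i)) m with hy | hy
        · rw [hglt _ hy, insertWord_of_lt hy]
        · obtain ⟨y, hy'⟩ := Nat.exists_eq_add_of_le hy
          rw [hgge _ hy, hy', show m + y + n = m + z.length + y by omega, insertWord_add_length]

/-- The **Carlson–Simpson theorem**: for every finite coloring of the parameter words with `d`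
parameters over an alphabet with `m` letters, there is an infinite parameter word all of whose
reductions with `d` parameters have the same color. -/
theorem carlson_simpson (d : ℕ) : ∀ {m : ℕ}, 1 ≤ m → ∀ {κ : Type} [Finite κ]
    (c : (ℕ → ℕ) → κ), DeterminedBefore m (m + d) c →
    ∃ W, Rigid W ∧ FixesBelow m W ∧ ∃ k, ∀ A, Rigid A → FixesBelow m A → c (A ∘ W) = k := by
  induction d with
  | zero => exact fun hm _ _ c hc => exists_monochromatic_words hm c hc
  | succ d ih =>
    intro m hm κ _ c hc
    let Q : ℕ → (ℕ → ℕ) → Prop := fun n W => ∀ A B, Rigid A → Rigid B → FixesBelow m A →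
      FixesBelow m B → FirstAt m A (m + n) → FirstAt m B (m + n) →
      (∀ i < m + n, A i = B i) → c (A ∘ W) = c (B ∘ W)
    obtain ⟨W, hW, hWP⟩ := exists_fusion (m := m)
      (fun n W => FixesBelow m W ∧ ∀ n', n = n' + 1 → Q n' W) Rigid.id
      ⟨fun _ _ => rfl, fun n' h => by omega⟩ (by
        rintro n W hW ⟨hWm, -⟩
        let E : (Fin n → Fin m) → ℕ → ℕ := fun u =>
          insertWord m (List.ofFn fun i => (u i : ℕ))
        have hElt : ∀ u : Fin n → Fin m, ∀ a ∈ List.ofFn (fun i => (u i : ℕ)), a < m := by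
          intro u a ha
          obtain ⟨i, rfl⟩ := (List.mem_ofFn' _ _).1 ha
          exact (u i).2
        have hE : ∀ u, Rigid (E u) := fun u => rigid_insertWord (hElt u)
        obtain ⟨Y, hY, hYm, k, hk⟩ := ih (m := m + 1) (by omega)
          (fun A u => c (A ∘ (E u ∘ W))) (by
            intro A B hA hB hAm hBm N hAN hBN hAB
            funext u
            exact hc.comp (m' := m + 1) ((hE u).comp hW) (by omega)
              ((fixesBelow_insertWord _ _).comp hWm) A B hA hB hAm hBm N
              (by rwa [show m + (d + 1) = m + 1 + d by omega])
              (by rwa [show m + (d + 1) = m + 1 + d by omega]) hAB)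
        obtain ⟨X, hX, hXm, hEX⟩ := exists_rigid_shift n hY hYm
        refine ⟨X, hX, hXm, (hXm.mono (by omega)).comp hWm, fun n' hn => ?_⟩
        obtain rfl : n = n' := by omega
        intro A B hA hB hAm hBm hAN hBN hAB
        let u : Fin n → Fin m := fun i => ⟨A (m + i), hAN.2 _ (by omega)⟩
        have hcolor : ∀ C, Rigid C → FixesBelow m C → FirstAt m C (m + n) →
            (∀ i < m + n, A i = C i) → c (C ∘ X ∘ W) = k u := by
          intro C hC hCm hCN hAC
          obtain ⟨C', hC', hC'm, rfl⟩ := exists_eq_comp_insertWord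
            (z := List.ofFn fun i => (u i : ℕ)) hC hCm hCN (by simp) (by
              intro i hi
              simp only [List.length_ofFn] at hi
              rw [List.getElem_ofFn]
              exact hAC _ (by omega))
          rw [← hk C' hC' hC'm]
          have := hEX _ (by simp) (hElt u)
          change c (C' ∘ (insertWord m _ ∘ X) ∘ W) = c (C' ∘ (Y ∘ insertWord m _) ∘ W)
          rw [this]
        rw [hcolor A hA hAm hAN fun _ _ => rfl, hcolor B hB hBm hBN hAB])
    have hWm : FixesBelow m W := by
      obtain ⟨V, Y, -, -, hY, ⟨hV, -⟩, rfl⟩ := hWP 0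
      exact (hY.mono (by omega)).comp hV
    obtain ⟨V, hV, hVm, k, hk⟩ := exists_monochromatic_words hm (fun A => c (A ∘ W)) (by
      intro A B hA hB hAm hBm N hAN hBN hAB
      obtain ⟨n, rfl⟩ := Nat.exists_eq_add_of_le (hAN.le hAm)
      obtain ⟨W', Y, hW', hY, hYfix, ⟨-, hQ⟩, rfl⟩ := hWP (n + 1)
      have hYm : FixesBelow m Y := hYfix.mono (by omega)
      have hYn : FixesBelow (m + n + 1) Y := hYfix.mono (by omega)
      refine hQ n rfl (A ∘ Y) (B ∘ Y) (hA.comp hY) (hB.comp hY) (hAm.comp hYm) (hBm.comp hYm)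
        (hAN.comp_of_fixesBelow hYn) (hBN.comp_of_fixesBelow hYn) fun i hi => ?_
      simp [hYn i (by omega), hAB i hi])
    exact ⟨V ∘ W, hV.comp hW, hVm.comp hWm, k, fun A hA hAm => hk A hA hAm⟩

theorem FirstAt.unique {k : ℕ} {A : ℕ → ℕ} {N M : ℕ} (hN : FirstAt k A N)
    (hM : FirstAt k A M) : N = M := by
  rcases lt_trichotomy N M with h | h | h
  · exact absurd hN.1 (hM.2 N h).ne
  · exact h
  · exact absurd hM.1 (hN.2 M h).ne

theorem Rigid.firstAt_mono {A : ℕ → ℕ} (hA : Rigid A) {k l N M : ℕ} (hN : FirstAt k A N)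
    (hM : FirstAt l A M) (hkl : k < l) : N < M := by
  obtain ⟨j, hj, hj'⟩ := hA.exists_lt M k (by rw [hM.1]; exact hkl)
  by_contra! h
  exact (hN.2 j (by omega)).ne hj'

/-- The first position at which `A` takes the value `k`. -/
noncomputable def firstPos (A : ℕ → ℕ) (k : ℕ) : ℕ := sInf {i | A i = k}

theorem Rigid.firstAt_firstPos {A : ℕ → ℕ} (hA : Rigid A) (k : ℕ) :
    FirstAt k A (firstPos A k) := by
  obtain ⟨N, hN⟩ := hA.exists_firstAt k
  have hmem : firstPos A k ∈ {i | A i = k} := Nat.sInf_mem ⟨N, hN.1⟩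
  have hle : firstPos A k ≤ N := Nat.sInf_le hN.1
  exact ⟨hmem, fun i hi => hN.2 i (hi.trans_le hle)⟩

theorem FirstAt.firstPos_eq {k : ℕ} {A : ℕ → ℕ} {N : ℕ} (hA : Rigid A) (hN : FirstAt k A N) :
    firstPos A k = N :=
  (hA.firstAt_firstPos k).unique hN

/-- Every map with infinite range has the same fibers as a rigid surjection. -/
theorem exists_rigid_same_fibers {τ : Type*} [DecidableEq τ] (key : ℕ → τ)
    (hkey : (Set.range key).Infinite) :
    ∃ A, Rigid A ∧ (∀ i j, A i = A j ↔ key i = key j) ∧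
      ∀ i, A i < ((Finset.range (i + 1)).image key).card := by
  let g : ℕ → ℕ := fun p => ((Finset.range p).image key).card
  let f : ℕ → ℕ := fun i => Nat.find (⟨i, rfl⟩ : ∃ j, key j = key i)
  have hf : ∀ i, key (f i) = key i := fun i => Nat.find_spec (⟨i, rfl⟩ : ∃ j, key j = key i)
  have hfle : ∀ i j, key j = key i → f i ≤ j := fun i j h => Nat.find_min' _ h
  have hfeq : ∀ i j, key i = key j → f i = f j := fun i j h =>
    le_antisymm (hfle _ _ ((hf j).trans h.symm)) (hfle _ _ ((hf i).trans h))
  have hg : Monotone g := fun p q h =>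
    Finset.card_le_card (Finset.image_subset_image (Finset.range_mono h))
  have hnew : ∀ p, f p = p → g (p + 1) = g p + 1 := by
    intro p hp
    simp only [g, Finset.range_add_one, Finset.image_insert]
    refine Finset.card_insert_of_notMem fun h => ?_
    obtain ⟨j, hj, hj'⟩ := Finset.mem_image.1 h
    have := hfle p j hj'
    have := Finset.mem_range.1 hj
    omega
  have hold : ∀ p, f p ≠ p → g (p + 1) = g p := by
    intro p hp
    simp only [g, Finset.range_add_one, Finset.image_insert]
    rw [Finset.insert_eq_of_mem]
    have := hfle p p rfl
    exact Finset.mem_image.2 ⟨f p, Finset.mem_range.2 (by omega), hf p⟩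
  have hattain : ∀ v P, v < g P → ∃ p < P, g (f p) = v := by
    intro v P
    induction P with
    | zero => simp [g]
    | succ P ih =>
      intro hv
      by_cases hP : f P = P
      · rw [hnew P hP] at hv
        rcases (Nat.lt_succ_iff.1 hv).lt_or_eq with h | h
        · obtain ⟨p, hp, hp'⟩ := ih h
          exact ⟨p, by omega, hp'⟩
        · exact ⟨P, by omega, by rw [hP, h]⟩
      · rw [hold P hP] at hv
        obtain ⟨p, hp, hp'⟩ := ih hv
        exact ⟨p, by omega, hp'⟩
  have hff : ∀ i, f (f i) = f i := fun i => hfeq _ _ (hf i)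
  have hlt : ∀ i j, f i < f j → g (f i) < g (f j) := fun i j h => by
    have h₁ := hnew _ (hff i)
    have h₂ : g (f i + 1) ≤ g (f j) := hg h
    omega
  refine ⟨fun i => g (f i), ⟨fun i v hv => ?_, fun v => ?_⟩, fun i j => ⟨fun h => ?_, fun h => ?_⟩,
    fun i => ?_⟩
  · obtain ⟨p, hp, hp'⟩ := hattain v _ hv
    exact ⟨p, hp.trans_le (hfle i i rfl), hp'⟩
  · obtain ⟨t, ht, htc⟩ := hkey.exists_subset_card_eq (v + 1)
    have hpre : ∀ x ∈ t, ∃ p, key p = x := fun x hx => ht hx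
    choose! pos hpos using hpre
    obtain ⟨P, hP⟩ := (t.image pos).exists_nat_subset_range
    have hsub : t ⊆ (Finset.range P).image key := fun x hx =>
      Finset.mem_image.2 ⟨pos x, hP (Finset.mem_image_of_mem pos hx), hpos x hx⟩
    have hcard : t.card ≤ g P := Finset.card_le_card hsub
    obtain ⟨p, -, hp'⟩ := hattain v P (by omega)
    exact ⟨p, hp'⟩
  · rcases lt_trichotomy (f i) (f j) with h' | h' | h'
    · exact absurd h (hlt i j h').ne
    · rw [← hf i, h', hf j]
    · exact absurd h (hlt j i h').ne'
  · simp only [hfeq i j h]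
  · have h₁ := hnew _ (hff i)
    have h₂ : g (f i + 1) ≤ g (i + 1) := hg (by have := hfle i i rfl; omega)
    change g (f i) < g (i + 1)
    omega

/-- The vertices of the graph of finite words: `(n, s)` stands for the word of length `n` in the
letters `0` and `1` whose set of occurrences of `1` is `s`. -/
abbrev WordVertex : Type := ℕ × Finset ℕ

/-- The adjacency of a word to a longer word: the longer one has the letter `1` at the position
where the shorter one ends, and the two words have no earlier common occurrence of `1`. -/
def WordLink (x y : WordVertex) : Prop :=
  x.1 < y.1 ∧ x.1 ∈ y.2 ∧ ∀ i < x.1, i ∈ x.2 → i ∉ y.2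

/-- The triangle-free graph of finite words. -/
def wordGraph : SimpleGraph WordVertex where
  Adj x y := WordLink x y ∨ WordLink y x
  symm := ⟨fun _ _ h => h.symm⟩
  loopless := ⟨fun _ h => h.elim (fun h => h.1.ne rfl) fun h => h.1.ne rfl⟩

theorem wordGraph_cliqueFree : wordGraph.CliqueFree 3 := by
  intro t ht
  obtain ⟨a, b, c, hab, hac, hbc, -⟩ := SimpleGraph.is3Clique_iff.1 ht
  have key : ∀ x y z, WordLink x y → WordLink y z → WordLink x z → False :=
    fun x y z hxy hyz hxz => hyz.2.2 _ hxy.1 hxy.2.1 hxz.2.1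
  have cycle : ∀ x y z, WordLink x y → WordLink y z → WordLink z x → False :=
    fun x y z hxy hyz hzx => by
      have := hxy.1.trans (hyz.1.trans hzx.1)
      omega
  rcases hab with hab | hab <;> rcases hac with hac | hac <;> rcases hbc with hbc | hbc
  · exact key a b c hab hbc hac
  · exact key a c b hac hbc hab
  · exact cycle a b c hab hbc hac
  · exact key c a b hac hab hbc
  · exact key b a c hab hac hbc
  · exact cycle b a c hab hac hbc
  · exact key b c a hbc hac hab
  · exact key c b a hbc hab hac

/-- The action of infinite parameter words on finite words by substitution. -/
noncomputable def substWord (A : ℕ → ℕ) (x : WordVertex) : WordVertex :=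
  (firstPos A x.1, {i ∈ Finset.range (firstPos A x.1) | A i ∈ x.2})

theorem substWord_comp {A W : ℕ → ℕ} (hA : Rigid A) (hW : Rigid W) (x : WordVertex) :
    substWord W (substWord A x) = substWord (A ∘ W) x := by
  have h₁ := hA.firstAt_firstPos x.1
  have h₂ := hW.firstAt_firstPos (firstPos A x.1)
  have h := (h₁.comp h₂).firstPos_eq (hA.comp hW)
  refine Prod.ext h.symm (Finset.ext fun i => ?_)
  simp only [substWord, h, Finset.mem_filter, Finset.mem_range, Function.comp_apply]
  exact ⟨fun h => ⟨h.1, h.2.2⟩, fun h => ⟨h.1, h₂.2 i h.1, h.2⟩⟩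

theorem substWord_congr {A B : ℕ → ℕ} (hA : Rigid A) (hB : Rigid B) {k N : ℕ}
    (hAN : FirstAt k A N) (hBN : FirstAt k B N) (hAB : ∀ i < N, A i = B i) {x : WordVertex}
    (hx : x.1 ≤ k) : substWord A x = substWord B x := by
  have hpos : FirstAt x.1 A (firstPos A x.1) := hA.firstAt_firstPos x.1
  have hle : firstPos A x.1 ≤ N := by
    rcases hx.lt_or_eq with h | h
    · exact (hA.firstAt_mono hpos hAN h).le
    · rw [h] at hpos ⊢
      exact (hpos.unique hAN).le
  have hposB : FirstAt x.1 B (firstPos A x.1) := by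
    refine ⟨?_, fun i hi => by rw [← hAB i (by omega)]; exact hpos.2 i hi⟩
    rcases hle.lt_or_eq with h | h
    · rw [← hAB _ h, hpos.1]
    · have := hpos.1
      rw [h] at this ⊢
      rw [hBN.1, ← this, hAN.1]
  have h := hposB.firstPos_eq hB
  refine Prod.ext h.symm (Finset.ext fun i => ?_)
  simp only [substWord, h, Finset.mem_filter, Finset.mem_range]
  exact and_congr_right fun hi => by rw [hAB i (by omega)]

theorem wordLink_substWord {A : ℕ → ℕ} (hA : Rigid A) (x y : WordVertex) :
    WordLink (substWord A x) (substWord A y) ↔ WordLink x y := by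
  have hx := hA.firstAt_firstPos x.1
  have hy := hA.firstAt_firstPos y.1
  have hlt : firstPos A x.1 < firstPos A y.1 ↔ x.1 < y.1 := by
    refine ⟨fun h => ?_, hA.firstAt_mono hx hy⟩
    have := hy.2 _ h
    rwa [hx.1] at this
  simp only [WordLink, substWord, Finset.mem_filter, Finset.mem_range, hx.1, hlt]
  refine and_congr_right fun hxy => ?_
  simp only [hxy, true_and]
  refine and_congr_right fun _ => ⟨fun h i hi hix hiy => ?_, fun h i hi hix hiy => ?_⟩
  · have hp := hA.firstAt_firstPos i
    have hlt' := hA.firstAt_mono hp hx hi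
    exact h _ hlt' ⟨hlt', by rwa [hp.1]⟩ ⟨hlt'.trans (hlt.2 hxy), by rwa [hp.1]⟩
  · exact h _ (hx.2 i hi) hix.2 hiy.2

theorem wordGraph_adj_substWord {A : ℕ → ℕ} (hA : Rigid A) (x y : WordVertex) :
    wordGraph.Adj (substWord A x) (substWord A y) ↔ wordGraph.Adj x y :=
  or_congr (wordLink_substWord hA x y) (wordLink_substWord hA y x)

/-- Every set of `q` words has an envelope: it is the image of one of finitely many sets of words
under a rigid surjection. -/
theorem exists_envelope (F : Finset WordVertex) (hF : ∀ x ∈ F, x.2 ⊆ Finset.range x.1) {k : ℕ}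
    (hk : 2 ^ F.card * 2 ^ F.card ≤ k) :
    ∃ A, Rigid A ∧ ∃ F' ⊆ Finset.range (k + 1) ×ˢ (Finset.range k).powerset,
      F = F'.image (substWord A) := by
  classical
  let N := F.sup Prod.fst + 1
  have hN : ∀ x ∈ F, x.1 < N := fun x hx => Nat.lt_succ_of_le (Finset.le_sup (f := Prod.fst) hx)
  let type : ℕ → Finset WordVertex × Finset WordVertex := fun i =>
    ({x ∈ F | i ∈ x.2}, {x ∈ F | x.1 = i})
  let key : ℕ → (Finset WordVertex × Finset WordVertex) ⊕ ℕ := fun i =>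
    if i < N then Sum.inl (type i) else Sum.inr i
  have hkeylt : ∀ i < N, key i = Sum.inl (type i) := fun i hi => by simp [key, hi]
  have hkeyge : ∀ i, N ≤ i → key i = Sum.inr i := fun i hi => by simp [key, hi]
  have hkeyeq : ∀ i j, j < N → key i = key j → type i = type j := by
    intro i j hj h
    rw [hkeylt j hj] at h
    rcases lt_or_ge i N with hi | hi
    · rw [hkeylt i hi] at h
      exact Sum.inl_injective h
    · rw [hkeyge i hi] at h
      exact absurd h Sum.inr_ne_inl
  have hinf : (Set.range key).Infinite := by
    refine Set.Infinite.mono (s := Set.range fun i => key (N + i)) ?_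
      (Set.infinite_range_of_injective fun i j h => ?_)
    · rintro _ ⟨i, rfl⟩
      exact ⟨_, rfl⟩
    · simp only [hkeyge _ (Nat.le_add_right N _)] at h
      have := Sum.inr_injective h
      omega
  obtain ⟨A, hA, hAkey, hAcard⟩ := exists_rigid_same_fibers key hinf
  have hAlt : ∀ i < N, A i < k := by
    intro i hi
    refine (hAcard i).trans_le (le_trans ?_ hk)
    have hsub : (Finset.range (i + 1)).image key ⊆
        (F.powerset ×ˢ F.powerset).image Sum.inl := by
      intro a ha
      obtain ⟨j, hj, rfl⟩ := Finset.mem_image.1 ha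
      have := Finset.mem_range.1 hj
      rw [hkeylt j (by omega)]
      refine Finset.mem_image_of_mem _ (Finset.mem_product.2 ⟨?_, ?_⟩) <;>
        exact Finset.mem_powerset.2 (Finset.filter_subset _ _)
    refine (Finset.card_le_card hsub).trans (Finset.card_image_le.trans ?_)
    rw [Finset.card_product, Finset.card_powerset]
  let shrink : WordVertex → WordVertex := fun x => (A x.1, x.2.image A)
  have hshrink : ∀ x ∈ F, substWord A (shrink x) = x := by
    intro x hx
    have hfst : firstPos A (A x.1) = x.1 := by
      have h := (hA.firstAt_firstPos (A x.1)).1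
      have h' := congrArg Prod.snd (hkeyeq _ _ (hN x hx) ((hAkey _ _).1 h))
      have hmem : x ∈ (type x.1).2 := Finset.mem_filter.2 ⟨hx, rfl⟩
      rw [← h'] at hmem
      exact (Finset.mem_filter.1 hmem).2.symm
    refine Prod.ext hfst (Finset.ext fun i => ?_)
    simp only [substWord, shrink, hfst, Finset.mem_filter, Finset.mem_range, Finset.mem_image]
    constructor
    · rintro ⟨hi, j, hj, hij⟩
      have hjN := (Finset.mem_range.1 (hF x hx hj)).trans (hN x hx)
      have h' := congrArg Prod.fst (hkeyeq _ _ hjN ((hAkey _ _).1 hij.symm))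
      have hmem : x ∈ (type j).1 := Finset.mem_filter.2 ⟨hx, hj⟩
      rw [← h'] at hmem
      exact (Finset.mem_filter.1 hmem).2
    · exact fun hi => ⟨Finset.mem_range.1 (hF x hx hi), i, hi, rfl⟩
  refine ⟨A, hA, F.image shrink, fun y hy => ?_, ?_⟩
  · obtain ⟨x, hx, rfl⟩ := Finset.mem_image.1 hy
    refine Finset.mem_product.2 ⟨Finset.mem_range.2 ((hAlt _ (hN x hx)).trans (by omega)),
      Finset.mem_powerset.2 fun a ha => ?_⟩
    obtain ⟨i, hi, rfl⟩ := Finset.mem_image.1 ha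
    exact Finset.mem_range.2 (hAlt i ((Finset.mem_range.1 (hF x hx hi)).trans (hN x hx)))
  · have h : F.image (substWord A ∘ shrink) = F.image id :=
      Finset.image_congr fun x hx => hshrink x hx
    rw [Finset.image_image, h, Finset.image_id]

/-- Finite big Ramsey degrees for sets of words: substituting into a suitable infinite parameter
word, the sets of `q` words take a number of colors bounded in terms of `q`. -/
theorem exists_bounded_colors (q : ℕ) : ∃ n : ℕ, 0 < n ∧ ∀ {κ : Type} [Finite κ]
    (c : Finset WordVertex → κ), ∃ W, Rigid W ∧ ∃ colors : Finset κ, colors.card ≤ n ∧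
      ∀ F : Finset WordVertex, F.card = q → (∀ x ∈ F, x.2 ⊆ Finset.range x.1) →
        c (F.image (substWord W)) ∈ colors := by
  classical
  let k := 1 + 2 ^ q * 2 ^ q
  let patterns := (Finset.range (k + 1) ×ˢ (Finset.range k).powerset).powerset
  refine ⟨patterns.card, Finset.card_pos.2 ⟨∅, Finset.empty_mem_powerset _⟩, fun {κ} _ c => ?_⟩
  obtain ⟨W, hW, -, col, hcol⟩ := carlson_simpson (2 ^ q * 2 ^ q) le_rfl
    (fun A (p : patterns) => c (p.1.image (substWord A))) (by
      intro A B hA hB _ _ N hAN hBN hAB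
      funext p
      refine congrArg c (Finset.image_congr fun x hx => ?_)
      have hmem := Finset.mem_product.1 (Finset.mem_powerset.1 p.2 hx)
      exact substWord_congr hA hB hAN hBN hAB (Nat.lt_succ_iff.1 (Finset.mem_range.1 hmem.1)))
  refine ⟨W, hW, Finset.univ.image col, ?_, fun F hFq hF => ?_⟩
  · refine Finset.card_image_le.trans ?_
    rw [Finset.card_univ, Fintype.card_coe]
  · obtain ⟨A, hA, F', hF', rfl⟩ := exists_envelope F hF (k := k) (by rw [hFq]; omega)
    refine Finset.mem_image.2 ⟨⟨F', Finset.mem_powerset.2 hF'⟩, Finset.mem_univ _, ?_⟩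
    have hA0 : FixesBelow 1 A := fun i hi => by
      have := hA.le_self i
      omega
    rw [← hcol A hA hA0, Finset.image_image]
    exact congrArg c (Finset.image_congr fun x _ => (substWord_comp hA hW x).symm)

/-- Every countable triangle-free graph is an induced subgraph of `wordGraph`. -/
theorem exists_word_representation {V : Type*} [Countable V] (H : SimpleGraph V)
    (hH : H.CliqueFree 3) :
    ∃ f : V → WordVertex, Function.Injective (fun v => (f v).1) ∧
      (∀ v, (f v).2 ⊆ Finset.range (f v).1) ∧ ∀ v w, wordGraph.Adj (f v) (f w) ↔ H.Adj v w := by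
  classical
  obtain ⟨enc, henc⟩ := exists_injective_nat V
  let f : V → WordVertex := fun v =>
    (enc v, {j ∈ Finset.range (enc v) | ∃ w, enc w = j ∧ H.Adj v w})
  have hmem : ∀ v w, enc w ∈ (f v).2 ↔ enc w < enc v ∧ H.Adj v w := by
    intro v w
    simp only [f, Finset.mem_filter, Finset.mem_range]
    refine and_congr_right fun _ => ⟨?_, fun h => ⟨w, rfl, h⟩⟩
    rintro ⟨w', hw', h⟩
    rwa [← henc hw']
  have hlink : ∀ v w, WordLink (f v) (f w) ↔ enc v < enc w ∧ H.Adj v w := by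
    intro v w
    constructor
    · exact fun h => ⟨h.1, ((hmem w v).1 h.2.1).2.symm⟩
    · rintro ⟨hlt, hadj⟩
      refine ⟨hlt, (hmem w v).2 ⟨hlt, hadj.symm⟩, fun i hi hiv hiw => ?_⟩
      obtain ⟨-, u, rfl, hu⟩ := Finset.mem_filter.1 hiv
      exact hH {v, w, u} (SimpleGraph.is3Clique_triple_iff.2 ⟨hadj, hu, ((hmem w u).1 hiw).2⟩)
  refine ⟨f, henc, fun v => Finset.filter_subset _ _, fun v w => ?_⟩
  change WordLink _ _ ∨ WordLink _ _ ↔ _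
  rw [hlink, hlink]
  constructor
  · rintro (h | h)
    · exact h.2
    · exact h.2.symm
  · intro h
    rcases lt_trichotomy (enc v) (enc w) with h' | h' | h'
    · exact Or.inl ⟨h', h⟩
    · exact absurd (henc h') h.ne
    · exact Or.inr ⟨h', h.symm⟩

theorem HensonExtProp.exists_nat_embedding {V : Type} {H : SimpleGraph V} (hH : HensonExtProp H)
    (Γ : SimpleGraph ℕ) (hΓ : Γ.CliqueFree 3) : Nonempty (Γ ↪g H) := by
  classical
  obtain ⟨v₀, -⟩ := hH ∅ ∅ (by simp) (by simp)
  let P : ℕ → (ℕ → V) → Prop := fun n f => ∀ i < n, ∀ j < n,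
    (f i = f j → i = j) ∧ (H.Adj (f i) (f j) ↔ Γ.Adj i j)
  have step : ∀ n f, P n f → ∃ v, P (n + 1) (Function.update f n v) := by
    intro n f hf
    obtain ⟨v, hvU, hvW, hU, hW⟩ := hH
      ({i ∈ Finset.range n | Γ.Adj n i}.image f) ({i ∈ Finset.range n | ¬ Γ.Adj n i}.image f)
      (by
        rw [Finset.disjoint_left]
        intro a ha ha'
        simp only [Finset.mem_image, Finset.mem_filter, Finset.mem_range] at ha ha'
        obtain ⟨i, hi, rfl⟩ := ha
        obtain ⟨j, hj, hij⟩ := ha'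
        exact hj.2 ((hf _ hj.1 _ hi.1).1 hij ▸ hi.2))
      (by
        intro a ha b hb hab
        simp only [Finset.mem_image, Finset.mem_filter, Finset.mem_range] at ha hb
        obtain ⟨i, hi, rfl⟩ := ha
        obtain ⟨j, hj, rfl⟩ := hb
        exact hΓ {n, i, j} (SimpleGraph.is3Clique_triple_iff.2
          ⟨hi.2, hj.2, (hf _ hi.1 _ hj.1).2.1 hab⟩))
    have hne : ∀ i < n, v ≠ f i := by
      rintro i hi rfl
      by_cases h : Γ.Adj n i
      · exact hvU (Finset.mem_image_of_mem f (by simp [hi, h]))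
      · exact hvW (Finset.mem_image_of_mem f (by simp [hi, h]))
    have hadj : ∀ i < n, H.Adj v (f i) ↔ Γ.Adj n i := by
      intro i hi
      by_cases h : Γ.Adj n i
      · exact iff_of_true (hU _ (Finset.mem_image_of_mem f (by simp [hi, h]))) h
      · exact iff_of_false (hW _ (Finset.mem_image_of_mem f (by simp [hi, h]))) h
    refine ⟨v, fun i hi j hj => ?_⟩
    rcases (Nat.lt_succ_iff.1 hi).lt_or_eq with hi | rfl <;>
      rcases (Nat.lt_succ_iff.1 hj).lt_or_eq with hj | rfl
    · simpa [Function.update_of_ne hi.ne, Function.update_of_ne hj.ne] using hf i hi j hj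
    · simpa [Function.update_of_ne hi.ne, (hne i hi).symm, hi.ne, H.adj_comm (f i), Γ.adj_comm i]
        using hadj i hi
    · simpa [Function.update_of_ne hj.ne, hne j hj, hj.ne'] using hadj j hj
    · simp
  have : Nonempty V := ⟨v₀⟩
  choose! ext hext using step
  let F : ℕ → ℕ → V := fun n =>
    Nat.rec (fun _ => v₀) (fun n f => Function.update f n (ext n f)) n
  have hFsucc : ∀ n, F (n + 1) = Function.update (F n) n (ext n (F n)) := fun _ => rfl
  have hF : ∀ n, P n (F n) := by
    intro n
    induction n with
    | zero => exact fun i hi => absurd hi (Nat.not_lt_zero i)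
    | succ n ih => exact hext n _ ih
  have hstable : ∀ i n, i + 1 ≤ n → F n i = F (i + 1) i := by
    intro i n hn
    induction n, hn using Nat.le_induction with
    | base => rfl
    | succ n hn ih => rw [hFsucc, Function.update_of_ne (by omega), ih]
  have hlim : ∀ i j, (F (i + 1) i = F (j + 1) j → i = j) ∧
      (H.Adj (F (i + 1) i) (F (j + 1) j) ↔ Γ.Adj i j) := by
    intro i j
    have h := hF (i + j + 1) i (by omega) j (by omega)
    rwa [hstable i (i + j + 1) (by omega), hstable j (i + j + 1) (by omega)] at h
  exact ⟨⟨⟨fun i => F (i + 1) i, fun i j h => (hlim i j).1 h⟩, fun {i j} => (hlim i j).2⟩⟩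

theorem HensonExtProp.exists_embedding {V X : Type} [Denumerable X] {H : SimpleGraph V}
    (hH : HensonExtProp H) (Γ : SimpleGraph X) (hΓ : Γ.CliqueFree 3) : Nonempty (Γ ↪g H) := by
  let e : Γ.comap (Denumerable.eqv X).symm ≃g Γ :=
    ⟨(Denumerable.eqv X).symm, Iff.rfl⟩
  obtain ⟨g⟩ := hH.exists_nat_embedding _ (hΓ.comap e.toEmbedding.isContained)
  exact ⟨g.comp e.symm.toEmbedding⟩

/-- **Dobrinen.** The universal triangle-free graph has finite big Ramsey degrees: for every
finite triangle-free graph `G` there is a positive integer `n` such that for every universal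
triangle-free graph `H₃` and every finite coloring of the induced copies of `G` in `H₃`,
there is an induced subgraph of `H₃` isomorphic to `H₃` in which the copies of `G` take at
most `n` colors. -/
theorem henson_finite_big_ramsey_degrees {W : Type} [Fintype W] (G : SimpleGraph W)
    (hG : G.CliqueFree 3) :
    ∃ n : ℕ, 0 < n ∧
      ∀ (V : Type) [Countable V] (H : SimpleGraph V),
        H.CliqueFree 3 → HensonExtProp H →
          ∀ (k : ℕ) (c : Set V → Fin (k + 1)),
            ∃ V' : Set V, Nonempty (H ≃g H.induce V') ∧
              ∃ colors : Finset (Fin (k + 1)), colors.card ≤ n ∧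
                ∀ S : Set V, S ⊆ V' → Nonempty (G ≃g H.induce S) → c S ∈ colors := by
  classical
  obtain ⟨n, hn, hcolors⟩ := exists_bounded_colors (Fintype.card W)
  refine ⟨n, hn, fun V _ H hH hext k c => ?_⟩
  obtain ⟨e⟩ := hext.exists_embedding wordGraph wordGraph_cliqueFree
  obtain ⟨f, hf, hfsub, hfadj⟩ := exists_word_representation H hH
  obtain ⟨A, hA, colors, hcard, hmem⟩ := hcolors fun F => c (e '' F)
  have hinj : Function.Injective fun v => e (substWord A (f v)) := by
    intro v w h
    have h' := congrArg (fun x => A x.1) (e.injective h)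
    simp only [substWord, (hA.firstAt_firstPos _).1] at h'
    exact hf h'
  have hadj : ∀ v w, H.Adj (e (substWord A (f v))) (e (substWord A (f w))) ↔ H.Adj v w := by
    intro v w
    rw [e.map_adj_iff, wordGraph_adj_substWord hA, hfadj]
  refine ⟨Set.range fun v => e (substWord A (f v)),
    ⟨⟨Equiv.ofInjective _ hinj, fun {v w} => hadj v w⟩⟩, colors, hcard, ?_⟩
  rintro S hS ⟨g⟩
  have : Finite S := Finite.of_equiv W g.toEquiv
  have hScard : S.ncard = Fintype.card W := by
    rw [← Nat.card_coe_set_eq, ← Nat.card_congr g.toEquiv, Nat.card_eq_fintype_card]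
  obtain ⟨T, rfl⟩ := Set.subset_range_iff_exists_image_eq.1 hS
  have hT : T.Finite := Set.Finite.of_finite_image (Set.toFinite _) hinj.injOn
  rw [Set.ncard_image_of_injective _ hinj] at hScard
  have hfinj : Function.Injective f := fun v w h => hf (congrArg Prod.fst h)
  have h := hmem (hT.toFinset.image f)
    (by rw [Finset.card_image_of_injective _ hfinj, ← Set.ncard_eq_toFinset_card T hT, hScard])
    (by
      intro x hx
      obtain ⟨v, -, rfl⟩ := Finset.mem_image.1 hx
      exact hfsub v)
  convert h using 2
  simp [Set.image_image]
end
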